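/- arXiv:2511.16409 — 3 statements merged into one kernel-verified Lean document; each statement's English description precedes it below -/
import Mathlib

section
/- Let A and B be groups. If every finitely generated subgroup of A is finitely presented and every finitely generated subgroup of B is finitely presented, then every finitely generated subgroup of the free product A * B is finitely presented. (This is the instance of the combination theorem for graphs of groups with two coherent vertex groups and trivial edge group: the free product of two coherent groups is coherent.) -/
/-- A group is finitely presented if it admits a presentation with finitely many
generators and finitely many relations. -/
def Group.FinitelyPresented (G : Type*) [Group G] : Prop :=
  ∃ (n : ℕ) (rels : Finset (FreeGroup (Fin n))),
    Nonempty (G ≃* PresentedGroup (rels : Set (FreeGroup (Fin n))))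

open Monoid

namespace CohFP

universe w

/-- A retract of a finitely presented group is finitely presented. -/
theorem retract {P H : Type*} [Group P] [Group H] [hP : Group.IsFinitelyPresented P]
    (s : H →* P) (ρ : P →* H) (h : ∀ x, ρ (s x) = x) : Group.IsFinitelyPresented H := by
  obtain ⟨n, φ, hφ, -⟩ := hP.out
  refine Group.IsFinitelyPresented.of_surjective ρ (fun x => ⟨s x, h x⟩) ?_
  let S : Set P := Set.range fun i : Fin n => (φ (FreeGroup.of i))⁻¹ * s (ρ (φ (FreeGroup.of i)))
  refine ⟨S, Set.finite_range _, le_antisymm ?_ ?_⟩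
  · apply Subgroup.normalClosure_le_normal
    rintro _ ⟨i, rfl⟩
    simp [MonoidHom.mem_ker, h]
  · intro p hp
    have key : (QuotientGroup.mk' (Subgroup.normalClosure S)).comp φ =
        (QuotientGroup.mk' (Subgroup.normalClosure S)).comp ((s.comp ρ).comp φ) := by
      ext i
      simp only [MonoidHom.comp_apply, QuotientGroup.mk'_apply]
      rw [QuotientGroup.eq]
      exact Subgroup.subset_normalClosure ⟨i, rfl⟩
    obtain ⟨w, rfl⟩ := hφ p
    have := DFunLike.congr_fun key w
    simp only [MonoidHom.comp_apply] at this
    rw [MonoidHom.mem_ker.1 hp, map_one, map_one] at this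
    simpa using this

/-- A free product of finitely presented groups, almost all trivial, is finitely presented. -/
theorem fp_coprodI {ι : Type*} {P : ι → Type*} [∀ i, Group (P i)]
    (h : ∀ i, Group.IsFinitelyPresented (P i)) (hf : {i | ¬ Subsingleton (P i)}.Finite) :
    Group.IsFinitelyPresented (CoprodI P) := by
  classical
  have : ∀ i, ∃ (n : ℕ) (φ : FreeGroup (Fin n) →* P i) (S : Set (FreeGroup (Fin n))),
      Function.Surjective φ ∧ S.Finite ∧ Subgroup.normalClosure S = φ.ker ∧
      (Subsingleton (P i) → n = 0 ∧ S = ∅) := by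
    intro i
    by_cases hs : Subsingleton (P i)
    · refine ⟨0, 1, ∅, fun x => ⟨1, Subsingleton.elim _ _⟩, Set.finite_empty, ?_, by simp⟩
      ext x
      have : x = 1 := Subsingleton.elim _ _
      simp [this]
    · obtain ⟨n, φ, hφ, S, hS, hS'⟩ := (h i).out
      exact ⟨n, φ, S, hφ, hS, hS', fun h => absurd h hs⟩
  choose n φ S hφ hS hker htriv using this
  have hfin : Finite (Σ i, Fin (n i)) := by
    have : Finite {i // ¬ Subsingleton (P i)} := hf
    refine Finite.of_injective
      (β := Σ i : {i // ¬ Subsingleton (P i)}, Fin (n i))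
      (fun x => ⟨⟨x.1, fun hs => ?_⟩, x.2⟩) ?_
    · have h1 := (htriv x.1 hs).1
      have h2 := x.2.2
      omega
    · rintro ⟨i, x⟩ ⟨j, y⟩ hxy
      simp only [Sigma.mk.injEq, Subtype.mk.injEq] at hxy
      obtain ⟨rfl, hxy⟩ := hxy
      simpa using hxy
  let Φ : FreeGroup (Σ i, Fin (n i)) →* CoprodI P :=
    FreeGroup.lift fun x => CoprodI.of (φ x.1 (FreeGroup.of x.2))
  let e : ∀ i, FreeGroup (Fin (n i)) →* FreeGroup (Σ i, Fin (n i)) :=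
    fun i => FreeGroup.map (fun a => (⟨i, a⟩ : Σ i, Fin (n i)))
  have hΦe : ∀ i w, Φ (e i w) = CoprodI.of (φ i w) := by
    intro i w
    have : Φ.comp (e i) = CoprodI.of.comp (φ i) := by
      ext x
      simp [Φ, e]
    exact DFunLike.congr_fun this w
  refine Group.IsFinitelyPresented.of_surjective Φ ?_ ⟨⋃ i, e i '' S i, ?_, ?_⟩
  · intro x
    induction x using CoprodI.induction_on with
    | one => exact ⟨1, map_one _⟩
    | of i m =>
      obtain ⟨w, rfl⟩ := hφ i m
      exact ⟨e i w, hΦe i w⟩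
    | mul x y hx hy =>
      obtain ⟨a, rfl⟩ := hx
      obtain ⟨b, rfl⟩ := hy
      exact ⟨a * b, map_mul _ _ _⟩
  · have : ⋃ i, e i '' S i = ⋃ i ∈ {i | ¬ Subsingleton (P i)}, e i '' S i := by
      ext w
      simp only [Set.mem_iUnion]
      constructor
      · rintro ⟨i, x, hx, rfl⟩
        refine ⟨i, fun hs => ?_, x, hx, rfl⟩
        rw [(htriv i hs).2] at hx
        exact hx
      · rintro ⟨i, -, hx⟩
        exact ⟨i, hx⟩
    rw [this]
    exact hf.biUnion fun i _ => (hS i).image _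
  · set N := Subgroup.normalClosure (⋃ i, e i '' S i) with hN
    apply le_antisymm
    · apply Subgroup.normalClosure_le_normal
      intro w hw
      simp only [Set.mem_iUnion] at hw
      obtain ⟨i, x, hx, rfl⟩ := hw
      have : x ∈ (φ i).ker := by
        rw [← hker]
        exact Subgroup.subset_normalClosure hx
      simp [MonoidHom.mem_ker, hΦe, MonoidHom.mem_ker.1 this]
    · have hle : ∀ i, (φ i).ker ≤ ((QuotientGroup.mk' N).comp (e i)).ker := by
        intro i
        rw [← hker]
        apply Subgroup.normalClosure_le_normal
        intro x hx
        simp only [SetLike.mem_coe, MonoidHom.mem_ker, MonoidHom.comp_apply,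
          QuotientGroup.mk'_apply, QuotientGroup.eq_one_iff]
        exact Subgroup.subset_normalClosure (Set.mem_iUnion.2 ⟨i, x, hx, rfl⟩)
      let Ψ : CoprodI P →* FreeGroup (Σ i, Fin (n i)) ⧸ N :=
        CoprodI.lift fun i => (φ i).liftOfSurjective (hφ i) ⟨_, hle i⟩
      have hΨ : Ψ.comp Φ = QuotientGroup.mk' N := by
        ext ⟨i, x⟩
        simp only [Ψ, Φ, MonoidHom.comp_apply, FreeGroup.lift_apply_of, CoprodI.lift_of]
        rw [MonoidHom.liftOfRightInverse_comp_apply]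
        simp [e]
      intro w hw
      have := DFunLike.congr_fun hΨ w
      rw [MonoidHom.comp_apply, MonoidHom.mem_ker.1 hw, map_one] at this
      exact (QuotientGroup.eq_one_iff w).1 this.symm

/-- The free product of subgroups embeds. -/
theorem lift_subgroup_injective {ι : Type*} {M : ι → Type*} [∀ i, Group (M i)]
    (K : ∀ i, Subgroup (M i)) :
    Function.Injective (CoprodI.lift fun i => (CoprodI.of (M := M) (i := i)).comp (K i).subtype) := by
  classical
  rw [injective_iff_map_eq_one]
  intro x hx
  obtain ⟨w, rfl⟩ := (CoprodI.Word.equiv (M := fun i => K i)).symm.surjective x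
  change CoprodI.lift _ (CoprodI.Word.prod w) = 1 at hx
  change CoprodI.Word.prod w = 1
  let w' : CoprodI.Word M :=
    { toList := w.toList.map fun l => ⟨l.1, (l.2 : M l.1)⟩
      ne_one := by
        intro l hl
        obtain ⟨l', hl', rfl⟩ := List.mem_map.1 hl
        have := w.ne_one l' hl'
        simpa using this
      chain_ne := by
        rw [List.isChain_map]
        exact w.chain_ne }
  have h1 : w'.prod = CoprodI.Word.empty.prod := by
    rw [CoprodI.Word.prod_empty, ← hx]
    simp only [CoprodI.Word.prod, w', map_list_prod, List.map_map]
    congr 1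
  have h2 : w' = CoprodI.Word.empty := (CoprodI.Word.equiv (M := M)).symm.injective h1
  have h3 : w.toList = [] := by
    have := congrArg CoprodI.Word.toList h2
    simpa [w'] using this
  simp [CoprodI.Word.prod, h3]

/-- Every finite subset lies in a finitely presented subgroup. -/
def Loc (Q : Type*) [Group Q] : Prop :=
  ∀ T : Set Q, T.Finite → ∃ K : Subgroup Q, T ⊆ K ∧ Group.IsFinitelyPresented K

theorem exists_finite_sigma {ι : Type*} {M : ι → Type*} [∀ i, Group (M i)]
    (x : CoprodI M) : ∃ T : Set (Σ i, M i), T.Finite ∧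
      x ∈ Subgroup.closure ((fun l : Σ i, M i => CoprodI.of l.2) '' T) := by
  induction x using CoprodI.induction_on with
  | one => exact ⟨∅, Set.finite_empty, one_mem _⟩
  | of i m => exact ⟨{⟨i, m⟩}, Set.finite_singleton _, Subgroup.subset_closure ⟨_, rfl, rfl⟩⟩
  | mul x y hx hy =>
    obtain ⟨T, hT, hx⟩ := hx
    obtain ⟨U, hU, hy⟩ := hy
    refine ⟨T ∪ U, hT.union hU, mul_mem ?_ ?_⟩
    · exact Subgroup.closure_mono (Set.image_mono Set.subset_union_left) hx
    · exact Subgroup.closure_mono (Set.image_mono Set.subset_union_right) hy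

theorem loc_coprodI {ι : Type*} {M : ι → Type*} [∀ i, Group (M i)]
    (hM : ∀ i, Loc (M i)) : Loc (CoprodI M) := by
  classical
  intro S hS
  choose T hT hTm using fun x : CoprodI M => exists_finite_sigma x
  let U : Set (Σ i, M i) := ⋃ x ∈ S, T x
  have hU : U.Finite := hS.biUnion fun x _ => hT x
  have : ∀ i, ∃ K : Subgroup (M i), {m | (⟨i, m⟩ : Σ i, M i) ∈ U} ⊆ K ∧
      Group.IsFinitelyPresented K ∧ (i ∉ Sigma.fst '' U → K = ⊥) := by
    intro i
    by_cases hi : i ∈ Sigma.fst '' U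
    · obtain ⟨K, hK, hK'⟩ := hM i {m | (⟨i, m⟩ : Σ i, M i) ∈ U}
        (hU.preimage (sigma_mk_injective.injOn))
      exact ⟨K, hK, hK', fun h => absurd hi h⟩
    · refine ⟨⊥, fun m hm => absurd ⟨_, hm, rfl⟩ hi, inferInstance, fun _ => rfl⟩
  choose K hK hKfp hKtriv using this
  let f := CoprodI.lift fun i => (CoprodI.of (M := M) (i := i)).comp (K i).subtype
  have hfp : Group.IsFinitelyPresented (CoprodI fun i => K i) := by
    apply fp_coprodI hKfp
    refine (hU.image Sigma.fst).subset fun i hi => ?_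
    by_contra h
    apply hi
    rw [hKtriv i h]
    infer_instance
  refine ⟨f.range, ?_, Group.IsFinitelyPresented.equiv
    (MonoidHom.ofInjective (lift_subgroup_injective K))⟩
  intro x hx
  refine (Subgroup.closure_le f.range).2 ?_ (hTm x)
  rintro _ ⟨⟨i, m⟩, hl, rfl⟩
  have : m ∈ K i := hK i (Set.mem_biUnion hx hl)
  exact ⟨CoprodI.of (⟨m, this⟩ : K i), by simp [f]⟩

/-- If `Q` is `Loc` and a finitely generated group `H` is a retract of `Q`, it is f.p. -/
theorem fp_of_loc {Q H : Type*} [Group Q] [Group H] (hQ : Loc Q) [hH : Group.FG H]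
    (s : H →* Q) (ρ : Q →* H) (h : ∀ x, ρ (s x) = x) : Group.IsFinitelyPresented H := by
  obtain ⟨S, hS, hSf⟩ := Group.fg_iff.1 hH
  obtain ⟨K, hK, hKfp⟩ := hQ (s '' S) (hSf.image _)
  have hs : ∀ x, s x ∈ K := by
    intro x
    have : x ∈ Subgroup.closure S := hS ▸ Subgroup.mem_top x
    have h2 : Subgroup.closure S ≤ K.comap s := by
      rw [Subgroup.closure_le]
      intro y hy
      exact hK ⟨y, hy, rfl⟩
    exact h2 this
  exact retract (s.codRestrict K hs) (ρ.comp K.subtype) h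

section cocycle

variable {G X Q : Type*} [Group G] [MulAction G X] [Group Q]

open scoped Classical in
/-- The cocycle on `C` built from homs on stabilizers and a function. -/
noncomputable def fam (C : Subgroup G)
    (j : ∀ x : X, ↥(MulAction.stabilizer G x ⊓ C) →* Q) (x : X) (g : G) : Q :=
  if h : g ∈ MulAction.stabilizer G x ⊓ C then j x ⟨g, h⟩ else 1

theorem fam_mul (C : Subgroup G)
    (j : ∀ x : X, ↥(MulAction.stabilizer G x ⊓ C) →* Q) (x : X) (g h : G)
    (hg : g ∈ MulAction.stabilizer G x ⊓ C) (hh : h ∈ MulAction.stabilizer G x ⊓ C) :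
    fam C j x (g * h) = fam C j x g * fam C j x h := by
  rw [fam, fam, fam, dif_pos hg, dif_pos hh, dif_pos (mul_mem hg hh), ← map_mul]
  rfl

theorem exists_cocycle (C : Subgroup G)
    (j : ∀ x : X, ↥(MulAction.stabilizer G x ⊓ C) →* Q) (u : X → Q)
    (r : X → X) (t : X → G) (ht : ∀ x, t x ∈ C) (hr : ∀ x, t x • r x = x)
    (hrC : ∀ x, ∀ g ∈ C, r (g • x) = r x) :
    ∃ F : C →* (X → Q) ⋊[mulAutArrow] G, ∀ c : C, (F c).right = c ∧
      ∀ y, (F c).left y = (u y)⁻¹ * fam C j (r y) ((t y)⁻¹ * c * t ((c : G)⁻¹ • y)) *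
        u ((c : G)⁻¹ • y) := by
  have hst : ∀ c ∈ C, ∀ y : X, (t y)⁻¹ * c * t (c⁻¹ • y) ∈ MulAction.stabilizer G (r y) ⊓ C := by
    intro c hc y
    refine Subgroup.mem_inf.2 ⟨?_, mul_mem (mul_mem (inv_mem (ht _)) hc) (ht _)⟩
    rw [MulAction.mem_stabilizer_iff, mul_smul, mul_smul]
    have h1 := hr (c⁻¹ • y)
    rw [hrC y c⁻¹ (inv_mem hc)] at h1
    rw [h1, smul_inv_smul, inv_smul_eq_iff, hr]
  refine ⟨MonoidHom.mk' (fun c => ⟨fun y => (u y)⁻¹ *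
    fam C j (r y) ((t y)⁻¹ * c * t ((c : G)⁻¹ • y)) * u ((c : G)⁻¹ • y), c⟩) ?_,
    fun c => ⟨rfl, fun y => rfl⟩⟩
  intro a b
  refine SemidirectProduct.ext ?_ rfl
  funext y
  change _ = _ * ((u ((a : G)⁻¹ • y))⁻¹ * fam C j (r ((a : G)⁻¹ • y))
    ((t ((a : G)⁻¹ • y))⁻¹ * b * t ((b : G)⁻¹ • (a : G)⁻¹ • y)) * u ((b : G)⁻¹ • (a : G)⁻¹ • y))
  have h1 := hst a a.2 y
  have h2 := hst b b.2 ((a : G)⁻¹ • y)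
  rw [hrC y _ (inv_mem a.2)] at h2 ⊢
  have h3 := fam_mul C j _ _ _ h1 h2
  have h4 : ((t y)⁻¹ * a * t ((a : G)⁻¹ • y)) *
      ((t ((a : G)⁻¹ • y))⁻¹ * b * t ((b : G)⁻¹ • (a : G)⁻¹ • y)) =
      (t y)⁻¹ * (a * b : G) * t ((a * b : G)⁻¹ • y) := by
    rw [mul_inv_rev, mul_smul]; group
  rw [h4] at h3
  simp only [Subgroup.coe_mul]
  rw [h3, mul_inv_rev, mul_smul]
  group

end cocycle

/-- The factors of the big free product. -/
def Fac {G X : Type*} [Group G] [MulAction G X] (C : Bool → Subgroup G) :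
    Bool × Bool × X → Type _
  | (k, true, x) => ↥(MulAction.stabilizer G x ⊓ C k)
  | (_, false, _) => FreeGroup PUnit

instance {G X : Type*} [Group G] [MulAction G X] (C : Bool → Subgroup G) :
    ∀ i, Group (Fac (X := X) C i)
  | (k, true, x) => inferInstanceAs (Group ↥(MulAction.stabilizer G x ⊓ C k))
  | (_, false, _) => inferInstanceAs (Group (FreeGroup PUnit))

theorem exists_reps {G X : Type*} [Group G] [MulAction G X] (C : Subgroup G) :
    ∃ (r : X → X) (t : X → G), (∀ x, t x ∈ C) ∧ (∀ x, t x • r x = x) ∧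
      (∀ x, ∀ g ∈ C, r (g • x) = r x) := by
  let q : X → MulAction.orbitRel.Quotient C X := Quotient.mk _
  have : ∀ x : X, ∃ g : C, g • (q x).out = x := by
    intro x
    have : (MulAction.orbitRel C X) x (q x).out := (MulAction.orbitRel C X).symm (Quotient.mk_out (s := MulAction.orbitRel C X) x)
    exact this
  choose g hg using this
  refine ⟨fun x => (q x).out, fun x => g x, fun x => (g x).2, fun x => hg x, ?_⟩
  intro x c hc
  have : q (c • x) = q x := Quotient.sound (⟨⟨c, hc⟩, rfl⟩ : c • x ∈ MulAction.orbit C x)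
  simp only [this]

theorem main {G : Type w} [Group G] (C : Bool → Subgroup G) (hgen : ⨆ k, C k = ⊤)
    (hlift : ∀ (N : Type w) [Group N] (f : ∀ k, C k →* N),
      ∃ F : G →* N, ∀ k (c : C k), F c = f k c)
    (hcoh : ∀ k (K : Subgroup G), K ≤ C k → K.FG → Group.IsFinitelyPresented K)
    (H : Subgroup G) (hH : H.FG) : Group.IsFinitelyPresented H := by
  classical
  have : Group.FG H := (Group.fg_iff_subgroup_fg H).2 hH
  let X := G ⧸ H
  let x0 : X := ((1 : G) : G ⧸ H)
  obtain ⟨τ, hτ, hτ0⟩ : ∃ τ : X → G, (∀ x, τ x • x0 = x) ∧ τ x0 = 1 := by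
    refine ⟨Function.update (fun x => x.out) x0 1, ?_, by simp⟩
    intro x
    by_cases hx : x = x0
    · subst hx; simp
    · rw [Function.update_of_ne hx]
      change ((x.out * 1 : G) : G ⧸ H) = x
      rw [mul_one]
      exact Quotient.out_eq' x
  have hstab : ∀ g : G, g • x0 = x0 → g ∈ H := by
    intro g hg
    have h1 : ((g * 1 : G) : G ⧸ H) = ((1 : G) : G ⧸ H) := hg
    rw [mul_one] at h1
    simpa using QuotientGroup.eq.1 h1.symm
  have hstab' : ∀ g ∈ H, g • x0 = x0 := by
    intro g hg
    change ((g * 1 : G) : G ⧸ H) = ((1 : G) : G ⧸ H)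
    rw [mul_one]
    symm
    rw [QuotientGroup.eq]
    simpa using hg
  have hconj : ∀ (g : G) (x y : X), g • y = x → (τ x)⁻¹ * g * τ y ∈ H := by
    intro g x y h
    apply hstab
    rw [mul_smul, mul_smul, hτ, h, inv_smul_eq_iff, hτ]
  choose r t ht hr hrC using fun k => exists_reps (X := X) (C k)
  let Q := CoprodI (Fac (X := X) C)
  have hQ : Loc Q := by
    apply loc_coprodI
    rintro ⟨k, b, x⟩ T hT
    cases b with
    | true =>
      change Set ↥(MulAction.stabilizer G x ⊓ C k) at T
      refine ⟨Subgroup.closure T, Subgroup.subset_closure, ?_⟩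
      let K' := (Subgroup.closure T).map (MulAction.stabilizer G x ⊓ C k).subtype
      have h1 : Group.IsFinitelyPresented K' := by
        apply hcoh k
        · rintro _ ⟨y, -, rfl⟩
          exact y.2.2
        · refine (Subgroup.fg_iff _).2 ⟨_, ?_, hT.image (MulAction.stabilizer G x ⊓ C k).subtype⟩
          exact (MonoidHom.map_closure _ _).symm
      exact Group.IsFinitelyPresented.equiv
        ((Subgroup.closure T).equivMapOfInjective _ (Subgroup.subtype_injective _)).symm
    | false =>
      refine ⟨⊤, fun _ _ => trivial, ?_⟩
      exact Group.IsFinitelyPresented.equiv (G := FreeGroup PUnit) Subgroup.topEquiv.symm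
  let j : ∀ k, ∀ x : X, ↥(MulAction.stabilizer G x ⊓ C k) →* Q :=
    fun k x => CoprodI.of (M := Fac (X := X) C) (i := (k, true, x))
  let u : Bool → X → Q := fun k x => CoprodI.of (M := Fac (X := X) C) (i := (k, false, x))
    (FreeGroup.of PUnit.unit : FreeGroup PUnit)
  let ρi : ∀ i : Bool × Bool × X, Fac C i →* H := fun i =>
    match i with
    | (k, true, x) => (MonoidHom.mk' (fun σ : ↥(MulAction.stabilizer G x ⊓ C k) =>
        (⟨(τ x)⁻¹ * σ * τ x, hconj _ _ _ σ.2.1⟩ : H)) (by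
          intro (a : ↥(MulAction.stabilizer G x ⊓ C k)) (b : ↥(MulAction.stabilizer G x ⊓ C k))
          ext
          change (τ x)⁻¹ * ((a : G) * (b : G)) * τ x = (τ x)⁻¹ * a * τ x * ((τ x)⁻¹ * b * τ x)
          group))
    | (k, false, x) => (FreeGroup.lift fun _ : PUnit =>
        (⟨(τ (r k x))⁻¹ * (t k x)⁻¹ * τ x, hconj _ _ _ (by rw [inv_smul_eq_iff, hr])⟩ : H))
  let ρ : Q →* H := CoprodI.lift ρi
  have hρj : ∀ k x σ, ((ρ (j k x σ) : H) : G) = (τ x)⁻¹ * σ * τ x := by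
    intro k x σ
    have : ρ (j k x σ) = ρi (k, true, x) σ := CoprodI.lift_of _ _
    rw [this]; rfl
  have hρu : ∀ k x, ((ρ (u k x) : H) : G) = (τ (r k x))⁻¹ * (t k x)⁻¹ * τ x := by
    intro k x
    have : ρ (u k x) = ρi (k, false, x) (FreeGroup.of PUnit.unit : FreeGroup PUnit) :=
      CoprodI.lift_of _ _
    rw [this]
    have h2 : ρi (k, false, x) (FreeGroup.of PUnit.unit : FreeGroup PUnit) =
      (⟨(τ (r k x))⁻¹ * (t k x)⁻¹ * τ x, hconj _ _ _ (by rw [inv_smul_eq_iff, hr])⟩ : H) :=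
      FreeGroup.lift_apply_of
    rw [h2]
  choose f hf using fun k => exists_cocycle (C k) (j k) (u k) (r k) (t k) (ht k) (hr k) (hrC k)
  obtain ⟨F, hF⟩ := hlift _ f
  have key : ∀ g : G, (F g).right = g ∧
      ∀ y, ((ρ ((F g).left y) : H) : G) = (τ y)⁻¹ * g * τ (g⁻¹ • y) := by
    intro g
    have hg : g ∈ ⨆ k, C k := hgen ▸ Subgroup.mem_top g
    refine Subgroup.iSup_induction C (C := fun g => (F g).right = g ∧
      ∀ y, ((ρ ((F g).left y) : H) : G) = (τ y)⁻¹ * g * τ (g⁻¹ • y)) hg ?_ ?_ ?_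
    · intro k c hc
      have h1 := hF k ⟨c, hc⟩
      have h2 := hf k ⟨c, hc⟩
      simp only at h1
      rw [h1]
      refine ⟨h2.1, fun y => ?_⟩
      rw [h2.2]
      have hmem : (t k y)⁻¹ * c * t k (c⁻¹ • y) ∈
          MulAction.stabilizer G (r k y) ⊓ C k := by
        refine Subgroup.mem_inf.2 ⟨?_, mul_mem (mul_mem (inv_mem (ht _ _)) hc) (ht _ _)⟩
        rw [MulAction.mem_stabilizer_iff, mul_smul, mul_smul]
        have h1 := hr k (c⁻¹ • y)
        rw [hrC k y c⁻¹ (inv_mem hc)] at h1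
        rw [h1, smul_inv_smul, inv_smul_eq_iff, hr]
      rw [fam, dif_pos hmem]
      simp only [map_mul, map_inv, Subgroup.coe_mul, Subgroup.coe_inv, hρj, hρu]
      rw [hrC k y c⁻¹ (inv_mem hc)]
      group
    · refine ⟨by simp, fun y => ?_⟩
      simp
    · intro a b ha hb
      refine ⟨by simp [ha.1, hb.1], fun y => ?_⟩
      have h1 : (F (a * b)).left y = (F a).left y * (F b).left (a⁻¹ • y) := by
        rw [map_mul, SemidirectProduct.mul_left, ha.1]
        rfl
      rw [h1, map_mul, Subgroup.coe_mul, ha.2, hb.2, mul_inv_rev, mul_smul]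
      group
  let s : H →* Q := MonoidHom.mk' (fun h => (F h).left x0) (by
    intro a b
    have h1 : (F ((a : G) * b)).left x0 = (F a).left x0 * (F b).left ((a : G)⁻¹ • x0) := by
      rw [map_mul, SemidirectProduct.mul_left, (key a).1]
      rfl
    rw [hstab' _ (inv_mem a.2)] at h1
    exact h1)
  refine fp_of_loc hQ s ρ fun h => ?_
  have := (key h).2 x0
  rw [hstab' _ (inv_mem h.2), hτ0, inv_one, one_mul, mul_one] at this
  exact Subtype.ext this

theorem fp_iff {G : Type*} [Group G] :
    Group.FinitelyPresented G ↔ Group.IsFinitelyPresented G := by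
  constructor
  · rintro ⟨n, R, ⟨e⟩⟩
    exact Group.IsFinitelyPresented.equiv e.symm
  · intro h
    obtain ⟨n, s, hs, e⟩ := Group.IsFinitelyPresented.exists_mulEquiv_presentedGroup (G := G)
    refine ⟨n, hs.toFinset, ?_⟩
    rwa [hs.coe_toFinset]

theorem coh_range {A G : Type*} [Group A] [Group G]
    (hA : ∀ H : Subgroup A, H.FG → Group.FinitelyPresented H) (i : A →* G)
    (hi : Function.Injective i) (K : Subgroup G) (hK : K ≤ i.range) (hfg : K.FG) :
    Group.IsFinitelyPresented K := by
  have hmap : (K.comap i).map i = K := Subgroup.map_comap_eq_self hK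
  let e : K.comap i ≃* K :=
    ((K.comap i).equivMapOfInjective i hi).trans (MulEquiv.subgroupCongr hmap)
  have : Group.FG K := (Group.fg_iff_subgroup_fg K).2 hfg
  have h2 : Group.FG (K.comap i) :=
    Group.fg_of_surjective (f := e.symm.toMonoidHom) e.symm.surjective
  have h3 := fp_iff.1 (hA _ ((Group.fg_iff_subgroup_fg _).1 h2))
  exact Group.IsFinitelyPresented.equiv e

end CohFP

/-- The free product of two coherent groups is coherent: if every finitely generated
subgroup of `A` is finitely presented and every finitely generated subgroup of `B` is
finitely presented, then every finitely generated subgroup of the free product `A * B`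
is finitely presented. -/
theorem coherent_free_product {A B : Type*} [Group A] [Group B]
    (hA : ∀ H : Subgroup A, H.FG → Group.FinitelyPresented H)
    (hB : ∀ H : Subgroup B, H.FG → Group.FinitelyPresented H) :
    ∀ H : Subgroup (Monoid.Coprod A B), H.FG → Group.FinitelyPresented H := by
  intro H hH
  rw [CohFP.fp_iff]
  refine CohFP.main (fun k => match k with
    | true => (Coprod.inl : A →* Coprod A B).range
    | false => (Coprod.inr : B →* Coprod A B).range) ?_ ?_ ?_ H hH
  · rw [iSup_bool_eq]
    exact Coprod.range_inl_sup_range_inr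
  · intro N _ f
    refine ⟨Coprod.lift ((f true).comp (Coprod.inl : A →* Coprod A B).rangeRestrict)
      ((f false).comp (Coprod.inr : B →* Coprod A B).rangeRestrict), ?_⟩
    rintro (_ | _) ⟨_, a, rfl⟩
    · exact Coprod.lift_apply_inr _ _ _
    · exact Coprod.lift_apply_inl _ _ _
  · rintro (_ | _) K hK hfg
    · exact CohFP.coh_range hB _ Coprod.inr_injective K hK hfg
    · exact CohFP.coh_range hA _ Coprod.inl_injective K hK hfg
end

section
/- Let G be a group, let A and B be subgroups of G, and let φ : A → B be a group isomorphism. Let G*_φ denote the HNN extension of G over φ, i.e., the quotient of the free product G * ⟨t⟩ (with t generating an infinite cyclic group) by the relations t a t⁻¹ = φ(a) for all a ∈ A. If G is coherent and every subgroup of A is finitely generated, then G*_φ is coherent. (This is the case n = 1, m = 2 of the combination theorem for graphs of groups, for a graph with one vertex and one loop edge.) -/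
/-- A group is coherent if every finitely generated subgroup is finitely presented. -/
def Group.Coherent (G : Type*) [Group G] : Prop :=
  ∀ H : Subgroup G, H.FG → Group.FinitelyPresented H

namespace HNNCoh

universe u

/-- Non-backtracking walks of positive length starting at `x0`; `Red adj x0 x y` means that there
is one whose last step goes from `x` to `y`. -/
inductive Red {V : Type*} (adj : V → V → Prop) (x0 : V) : V → V → Prop
  | start (y : V) : adj x0 y → Red adj x0 x0 y
  | step (x y z : V) : Red adj x0 x y → adj y z → z ≠ x → Red adj x0 y z

theorem Red.last {V : Type*} {adj : V → V → Prop} {x0 x y : V} (h : Red adj x0 x y) :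
    adj x y := by
  cases h <;> assumption

theorem Red.map {X V : Type*} {adjX : X → X → Prop} {adj : V → V → Prop} (f : X → V)
    (hsymm : ∀ x y, adjX x y → adjX y x)
    (hf : ∀ x y, adjX x y → adj (f x) (f y))
    (hinj : ∀ x y z, adjX x y → adjX x z → f y = f z → y = z) {x0 x y : X}
    (h : Red adjX x0 x y) : Red adj (f x0) (f x) (f y) := by
  induction h with
  | start y h => exact .start _ (hf _ _ h)
  | step x y z h hyz hne ih =>
    exact .step _ _ _ ih (hf _ _ hyz) fun e => hne (hinj y z x hyz (hsymm _ _ h.last) e)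

theorem exists_red {X : Type*} {adjX : X → X → Prop} {x0 y : X}
    (h : Relation.ReflTransGen adjX x0 y) : y = x0 ∨ ∃ x, Red adjX x0 x y := by
  induction h with
  | refl => exact .inl rfl
  | @tail y z h hyz ih =>
    rcases ih with rfl | ⟨x, hx⟩
    · exact .inr ⟨_, .start _ hyz⟩
    · by_cases hzx : z = x
      · subst hzx
        cases hx with
        | start _ h => exact .inl rfl
        | step w _ _ h _ _ => exact .inr ⟨_, h⟩
      · exact .inr ⟨_, .step _ _ _ hx hyz hzx⟩

/-- A locally injective map from a connected graph to a tree is injective. -/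
theorem eq_of_map_eq {X V : Type*} {adjX : X → X → Prop} {adj : V → V → Prop} (f : X → V)
    (hsymm : ∀ x y, adjX x y → adjX y x)
    (hf : ∀ x y, adjX x y → adj (f x) (f y))
    (hinj : ∀ x y z, adjX x y → adjX x z → f y = f z → y = z)
    (htree : ∀ x0 x y, Red adj x0 x y → y ≠ x0) {x0 y : X}
    (h : Relation.ReflTransGen adjX x0 y) (e : f y = f x0) : y = x0 := by
  rcases exists_red h with h | ⟨x, hx⟩
  · exact h
  · exact absurd e (htree _ _ _ (hx.map f hsymm hf hinj))

/-- The covering setoid on `K × D`. -/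
def covSetoid {H K V : Type*} [Group H] [Group K] (D : Set V) (r : V → V) (hK : V → K)
    (N : V → Subgroup K) : Setoid (K × D) where
  r p q := r p.2 = r q.2 ∧ (p.1 * hK p.2)⁻¹ * (q.1 * hK q.2) ∈ N (r p.2)
  iseqv :=
    { refl := fun p => ⟨rfl, by simp⟩
      symm := by
        rintro p q ⟨h1, h2⟩
        refine ⟨h1.symm, ?_⟩
        rw [← h1]
        simpa [mul_assoc] using inv_mem h2
      trans := by
        rintro p q s ⟨h1, h2⟩ ⟨h3, h4⟩
        refine ⟨h1.trans h3, ?_⟩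
        rw [← h1] at h4
        simpa [mul_assoc] using mul_mem h2 h4 }

theorem core {H K V : Type*} [Group H] [Group K] [MulAction H V] (adj : V → V → Prop)
    (adj_symm : ∀ x y, adj x y → adj y x)
    (adj_smul : ∀ (g : H) x y, adj x y → adj (g • x) (g • y))
    (htree : ∀ x0 x y, Red adj x0 x y → y ≠ x0)
    (D : Set V) (v0 : V) (hv0 : v0 ∈ D)
    (hD : ∀ u : D, Relation.ReflTransGen (fun x y : D => adj x y) ⟨v0, hv0⟩ u)
    (r : V → V) (h : V → H) (hrD : ∀ u ∈ D, r u ∈ D)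
    (hrr : ∀ u ∈ D, r (r u) = r u)
    (hhu : ∀ u ∈ D, h u • r u = u)
    (hr : ∀ u (g : H), r (g • u) = r u)
    (L : V → Subgroup H) (ι : ∀ x, L x →* K) (hK : V → K) (π : K →* H)
    (hL : ∀ u ∈ D, ∀ l ∈ L (r u), l • r u = r u)
    (hπι : ∀ u ∈ D, ∀ l : L (r u), π (ι (r u) l) = l)
    (hπh : ∀ u ∈ D, π (hK u) = h u)
    (hh' : ∀ u ∈ D, hK (r u) = 1)
    (hE : ∀ u ∈ D, ∀ w ∈ D, ∀ u' ∈ D, ∀ w' ∈ D, adj u w → ∀ g : H, g • u = u' → g • w = w' →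
      ∃ (a : L (r u)) (b : L (r w)), (a : H) = (h u')⁻¹ * g * h u ∧ (b : H) = (h w')⁻¹ * g * h w ∧
        hK u' * ι _ a * (hK u)⁻¹ = hK w' * ι _ b * (hK w)⁻¹)
    (hgen : Subgroup.closure (hK '' D ∪ ⋃ u ∈ D, Set.range (ι (r u))) = ⊤) :
    Function.Injective π := by
  classical
  let N : V → Subgroup K := fun x => (ι x).range
  let s : Setoid (K × D) := covSetoid (H := H) D r hK N
  let X := Quotient s
  let F : X → V := Quotient.lift (fun p : K × D => π p.1 • (p.2 : V)) (by
    rintro ⟨k, u⟩ ⟨k', u'⟩ ⟨h1, l, hl⟩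
    have h2 := congrArg π hl
    rw [hπι _ u.2] at h2
    simp only [map_mul, map_inv, hπh _ u.2, hπh _ u'.2] at h2
    have h3 : π k' * h u' = π k * h u * l := by rw [h2]; group
    have h4 := hL u u.2 l l.2
    simp only [] at h1
    change π k • (u : V) = π k' • (u' : V)
    conv_lhs => rw [← hhu u u.2, ← h4]
    conv_rhs => rw [← hhu u' u'.2]
    rw [smul_smul, smul_smul, smul_smul, h3]
    exact congrArg _ h1)
  let adjX : X → X → Prop := fun p q => ∃ (k : K) (u w : D), adj u w ∧
    p = Quotient.mk s (k, u) ∧ q = Quotient.mk s (k, w)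
  have adjX_symm : ∀ x y, adjX x y → adjX y x := by
    rintro x y ⟨k, u, w, h1, h2, h3⟩
    exact ⟨k, w, u, adj_symm _ _ h1, h3, h2⟩
  have hF : ∀ x y, adjX x y → adj (F x) (F y) := by
    rintro x y ⟨k, u, w, h1, rfl, rfl⟩
    exact adj_smul _ _ _ h1
  have hinj : ∀ x y z, adjX x y → adjX x z → F y = F z → y = z := by
    rintro x y z ⟨k, u, w, h1, h2, rfl⟩ ⟨k', u', w', h1', h2', rfl⟩ e
    have hx := h2.symm.trans h2'
    have hFx : π k • (u : V) = π k' • (u' : V) := congrArg F hx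
    have hFe : π k • (w : V) = π k' • (w' : V) := e
    obtain ⟨h3, l, hl⟩ := Quotient.exact hx
    have gu : ((π k')⁻¹ * π k) • (u : V) = u' := by rw [mul_smul, hFx, inv_smul_smul]
    have gw : ((π k')⁻¹ * π k) • (w : V) = w' := by rw [mul_smul, hFe, inv_smul_smul]
    obtain ⟨a, b, ha, hb, hab⟩ := hE u u.2 w w.2 u' u'.2 w' w'.2 h1 _ gu gw
    have hl' : (l : H) = ((a⁻¹ : L (r u)) : H) := by
      have := congrArg π hl
      rw [hπι _ u.2] at this
      rw [this]
      simp [ha, hπh _ u.2, hπh _ u'.2, mul_assoc]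
    have hl2 : l = a⁻¹ := Subtype.ext hl'
    subst hl2
    apply Quotient.sound
    refine ⟨?_, b⁻¹, ?_⟩
    · rw [← gw, hr]
    · simp only [map_inv] at hl ⊢
      have hk : k' = k * hK u * (ι _ a)⁻¹ * (hK u')⁻¹ := by
        rw [hl]; group
      have hk2 : k' = k * hK w * (ι _ b)⁻¹ * (hK w')⁻¹ := by
        rw [hk]
        have := congrArg (fun x => k * x⁻¹) hab
        simpa [mul_assoc] using this
      rw [hk2]; group
  let x0 : X := Quotient.mk s (1, ⟨v0, hv0⟩)
  let R := Relation.ReflTransGen adjX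
  have R_symm : ∀ x y, R x y → R y x := by
    intro x y hxy
    induction hxy with
    | refl => exact Relation.ReflTransGen.refl
    | tail _ h ih => exact Relation.ReflTransGen.head (adjX_symm _ _ h) ih
  have conn1 : ∀ (k : K) (u : D), R (Quotient.mk s (k, ⟨v0, hv0⟩)) (Quotient.mk s (k, u)) := by
    intro k u
    induction hD u with
    | refl => exact Relation.ReflTransGen.refl
    | tail _ h ih => exact Relation.ReflTransGen.tail ih ⟨k, _, _, h, rfl, rfl⟩
  have conn2 : ∀ (k : K) (u w : D), R (Quotient.mk s (k, u)) (Quotient.mk s (k, w)) := fun k u w =>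
    (R_symm _ _ (conn1 k u)).trans (conn1 k w)
  have conn : ∀ k : K, ∀ u : D, R x0 (Quotient.mk s (k, u)) := by
    intro k
    have key : ∀ (k k' : K) (u u' : D), Quotient.mk s (k, u) = Quotient.mk s (k', u') →
        (∀ u : D, R x0 (Quotient.mk s (k, u))) → ∀ u : D, R x0 (Quotient.mk s (k', u)) := by
      intro k k' u u' e hk w
      have := hk u
      rw [e] at this
      exact this.trans (conn2 k' u' w)
    have hk : k ∈ Subgroup.closure (hK '' D ∪ ⋃ u ∈ D, Set.range (ι (r u))) := by
      rw [hgen]; trivial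
    induction hk using Subgroup.closure_induction_right with
    | one => exact conn1 1
    | mul_right x hx y hy ih =>
      rcases hy with ⟨u, hu, rfl⟩ | hy
      · refine key x _ ⟨u, hu⟩ ⟨r u, hrD u hu⟩ (Quotient.sound ⟨?_, ?_⟩) ih
        · simp [hrr u hu]
        · simp [hh' u hu, N]
      · simp only [Set.mem_iUnion] at hy
        obtain ⟨u, hu, l, rfl⟩ := hy
        refine key x _ ⟨r u, hrD u hu⟩ ⟨r u, hrD u hu⟩ (Quotient.sound ⟨rfl, ?_⟩) ih
        simp [hh' u hu, N, hrr u hu]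
    | mul_inv_cancel x hx y hy ih =>
      rcases hy with ⟨u, hu, rfl⟩ | hy
      · refine key x _ ⟨r u, hrD u hu⟩ ⟨u, hu⟩ (Quotient.sound ⟨?_, ?_⟩) ih
        · simp [hrr u hu]
        · simp [hh' u hu, N, hrr u hu]
      · simp only [Set.mem_iUnion] at hy
        obtain ⟨u, hu, l, rfl⟩ := hy
        refine key x _ ⟨r u, hrD u hu⟩ ⟨r u, hrD u hu⟩ (Quotient.sound ⟨rfl, ?_⟩) ih
        simp [hh' u hu, N, hrr u hu]
  rw [injective_iff_map_eq_one]
  intro k hk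
  have e := eq_of_map_eq F adjX_symm hF hinj htree (conn k ⟨v0, hv0⟩)
    (show π k • v0 = π 1 • v0 by rw [hk, map_one])
  obtain ⟨-, l, hl⟩ := Quotient.exact e
  have h1 := congrArg π hl
  rw [hπι _ hv0] at h1
  simp [hk] at h1
  subst h1
  have h2 : k⁻¹ = 1 := by
    have := congrArg (fun x => hK v0 * x * (hK v0)⁻¹) hl
    simpa [mul_assoc] using this.symm
  simpa using h2

theorem exists_fp_cover {H V : Type u} [Group H] (L : V → Subgroup H) (D : Set V) (hD : D.Finite)
    (h : V → H) (R : Set V) (hR : R.Finite)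
    (hL : ∀ x ∈ R, Group.IsFinitelyPresented (L x)) :
    ∃ (M : Type u) (_ : Group M) (_ : Group.IsFinitelyPresented M) (ι : ∀ x, L x →* M)
      (hK : V → M) (π : M →* H), (∀ x ∈ R, ∀ l, π (ι x l) = l) ∧ (∀ u ∈ D, π (hK u) = h u) ∧
      Subgroup.closure (hK '' D ∪ ⋃ x ∈ R, Set.range (ι x)) = ⊤ := by
  classical
  induction R, hR using Set.Finite.induction_on with
  | empty =>
    have : Finite D := hD
    refine ⟨FreeGroup D, inferInstance, inferInstance, fun _ => 1,
      fun u => if hu : u ∈ D then FreeGroup.of ⟨u, hu⟩ else 1,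
      FreeGroup.lift (fun u : D => h u), by simp, ?_, ?_⟩
    · intro u hu
      simp [hu]
    · rw [← top_le_iff, ← FreeGroup.closure_range_of, Subgroup.closure_le]
      rintro _ ⟨u, rfl⟩
      refine Subgroup.subset_closure (Or.inl ⟨u, u.2, by simp⟩)
  | @insert x R hx hR ih =>
    obtain ⟨M, _, _, ι, hK, π, h1, h2, h3⟩ := ih (fun y hy => hL y (Set.mem_insert_of_mem _ hy))
    have := hL x (Set.mem_insert _ _)
    refine ⟨Monoid.Coprod M (L x), inferInstance, inferInstance,
      Function.update (fun y => (Monoid.Coprod.inl).comp (ι y)) x Monoid.Coprod.inr,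
      fun u => Monoid.Coprod.inl (hK u), Monoid.Coprod.lift π (L x).subtype, ?_, ?_, ?_⟩
    · rintro y (rfl | hy) l
      · simp
      · have : y ≠ x := fun e => hx (e ▸ hy)
        simp [Function.update_of_ne this, h1 y hy]
    · intro u hu
      simp [h2 u hu]
    · rw [← top_le_iff, ← Monoid.Coprod.range_inl_sup_range_inr, sup_le_iff]
      constructor
      · rw [MonoidHom.range_eq_map, ← h3, MonoidHom.map_closure, Subgroup.closure_le]
        rintro _ ⟨y, hy, rfl⟩
        rcases hy with ⟨u, hu, rfl⟩ | hy
        · exact Subgroup.subset_closure (Or.inl ⟨u, hu, rfl⟩)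
        · simp only [Set.mem_iUnion] at hy
          obtain ⟨z, hz, l, rfl⟩ := hy
          have : z ≠ x := fun e => hx (e ▸ hz)
          refine Subgroup.subset_closure (Or.inr ?_)
          simp only [Set.mem_iUnion]
          refine ⟨z, Set.mem_insert_of_mem _ hz, l, ?_⟩
          simp [Function.update_of_ne this]
      · rintro _ ⟨l, rfl⟩
        refine Subgroup.subset_closure (Or.inr ?_)
        simp only [Set.mem_iUnion]
        refine ⟨x, Set.mem_insert _ _, l, ?_⟩
        simp

theorem exists_connected {V : Type*} (adj : V → V → Prop) (v0 : V)
    (hconn : ∀ x, Relation.ReflTransGen adj v0 x) (T : Set V) (hT : T.Finite) :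
    ∃ D : Set V, D.Finite ∧ T ⊆ D ∧ v0 ∈ D ∧
      ∀ u ∈ D, Relation.ReflTransGen (fun x y => adj x y ∧ x ∈ D ∧ y ∈ D) v0 u := by
  have one : ∀ x, ∃ D : Set V, D.Finite ∧ x ∈ D ∧ v0 ∈ D ∧
      ∀ u ∈ D, Relation.ReflTransGen (fun x y => adj x y ∧ x ∈ D ∧ y ∈ D) v0 u := by
    intro x
    induction hconn x with
    | refl => exact ⟨{v0}, Set.finite_singleton _, rfl, rfl, by
        rintro u rfl; exact Relation.ReflTransGen.refl⟩
    | @tail y z _ hyz ih =>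
      obtain ⟨D, h1, h2, h3, h4⟩ := ih
      have mono : ∀ u ∈ D, Relation.ReflTransGen
          (fun x y => adj x y ∧ x ∈ insert z D ∧ y ∈ insert z D) v0 u := fun u hu =>
        Relation.ReflTransGen.mono (fun a b hab => ⟨hab.1, Or.inr hab.2.1, Or.inr hab.2.2⟩) _ _
          (h4 u hu)
      refine ⟨insert z D, h1.insert z, Set.mem_insert _ _, Set.mem_insert_of_mem _ h3, ?_⟩
      rintro u (rfl | hu)
      · exact (mono y h2).tail ⟨hyz, Or.inr h2, Or.inl rfl⟩
      · exact mono u hu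
  choose D h1 h2 h3 h4 using one
  refine ⟨⋃ x ∈ insert v0 T, D x, (hT.insert v0).biUnion fun x _ => h1 x, ?_, ?_, ?_⟩
  · intro x hx
    exact Set.mem_biUnion (Set.mem_insert_of_mem _ hx) (h2 x)
  · exact Set.mem_biUnion (Set.mem_insert v0 T) (h3 v0)
  · intro u hu
    simp only [Set.mem_iUnion] at hu
    obtain ⟨x, hx, hu⟩ := hu
    exact Relation.ReflTransGen.mono (fun a b hab => ⟨hab.1, Set.mem_biUnion hx hab.2.1,
      Set.mem_biUnion hx hab.2.2⟩) _ _ (h4 x u hu)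

theorem exists_reps {H V : Type*} [Group H] [MulAction H V] (D : Set V) :
    ∃ (r : V → V) (h : V → H), (∀ u ∈ D, r u ∈ D) ∧ (∀ u, r (r u) = r u) ∧
      (∀ u, h u • r u = u) ∧ (∀ u (g : H), r (g • u) = r u) ∧ (∀ u, h (r u) = 1) := by
  classical
  let mk : V → MulAction.orbitRel.Quotient H V := Quotient.mk _
  have mk_smul : ∀ u (g : H), mk (g • u) = mk u := fun u g => Quotient.sound ⟨g, rfl⟩
  have : ∀ o : MulAction.orbitRel.Quotient H V, ∃ x : V, mk x = o ∧
      ((∃ y ∈ D, mk y = o) → x ∈ D) := by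
    intro o
    by_cases ho : ∃ y ∈ D, mk y = o
    · obtain ⟨y, hy, e⟩ := ho
      exact ⟨y, e, fun _ => hy⟩
    · obtain ⟨x, hx⟩ := Quotient.exists_rep o
      exact ⟨x, hx, fun h => absurd h ho⟩
  choose q hq1 hq2 using this
  have : ∀ u : V, ∃ g : H, g • q (mk u) = u ∧ (u = q (mk u) → g = 1) := by
    intro u
    by_cases e : u = q (mk u)
    · exact ⟨1, by rw [one_smul]; exact e.symm, fun _ => rfl⟩
    · obtain ⟨g, hg⟩ := Quotient.exact (hq1 (mk u)).symm
      exact ⟨g, hg, fun h => absurd h e⟩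
  choose h hh1 hh2 using this
  have hrr : ∀ u, q (mk (q (mk u))) = q (mk u) := fun u => by rw [hq1]
  exact ⟨fun u => q (mk u), h, fun u hu => hq2 _ ⟨u, hu, rfl⟩, hrr, hh1,
    fun u g => by simp only [mk_smul], fun u => hh2 _ (hrr u).symm⟩

theorem fp_of_tree {H V : Type u} [Group H] [MulAction H V] (adj : V → V → Prop)
    (adj_symm : ∀ x y, adj x y → adj y x)
    (adj_smul : ∀ (g : H) x y, adj x y → adj (g • x) (g • y))
    (htree : ∀ x0 x y, Red adj x0 x y → y ≠ x0) (v0 : V)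
    (hconn : ∀ x, Relation.ReflTransGen adj v0 x)
    (hvert : ∀ (v : V) (L : Subgroup H), L ≤ MulAction.stabilizer H v → L.FG →
      Group.IsFinitelyPresented L)
    (hedge : ∀ u w, adj u w → (MulAction.stabilizer H u ⊓ MulAction.stabilizer H w).FG)
    (S : Set H) (hS : S.Finite) (hS' : Subgroup.closure S = ⊤) :
    Group.IsFinitelyPresented H := by
  classical
  obtain ⟨D, hDfin, hSD, hv0, hDc⟩ := exists_connected adj v0 hconn ((fun s => s • v0) '' S)
    (hS.image _)
  obtain ⟨r, h, hrD, hrr, hhu, hr, hh1⟩ := exists_reps (H := H) D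
  obtain ⟨Z, hZfin, hSZ, hZ1, hZ2⟩ : ∃ Z : Set H, Z.Finite ∧ S ⊆ Z ∧
      (∀ u ∈ D, ∀ w ∈ D, adj u w →
        MulAction.stabilizer H u ⊓ MulAction.stabilizer H w ≤
          Subgroup.closure (Z ∩ (MulAction.stabilizer H u ⊓ MulAction.stabilizer H w : Subgroup H)))
      ∧ (∀ u ∈ D, ∀ w ∈ D, ∀ u' ∈ D, ∀ w' ∈ D, ∀ g : H, g • u = u' → g • w = w' →
        ∃ g0 ∈ Z, g0 • u = u' ∧ g0 • w = w') := by
    have e1 : ∀ u w, ∃ Y : Set H, Y.Finite ∧ (adj u w →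
        Subgroup.closure Y = MulAction.stabilizer H u ⊓ MulAction.stabilizer H w) := by
      intro u w
      by_cases huw : adj u w
      · obtain ⟨Y, hY, hY'⟩ := (Subgroup.fg_iff _).1 (hedge u w huw)
        exact ⟨Y, hY', fun _ => hY⟩
      · exact ⟨∅, Set.finite_empty, fun h => absurd h huw⟩
    have e2 : ∀ p : V × V × V × V, ∃ g : H, (∃ g' : H, g' • p.1 = p.2.2.1 ∧ g' • p.2.1 = p.2.2.2) →
        g • p.1 = p.2.2.1 ∧ g • p.2.1 = p.2.2.2 := by
      intro p
      by_cases hp : ∃ g' : H, g' • p.1 = p.2.2.1 ∧ g' • p.2.1 = p.2.2.2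
      · exact ⟨hp.choose, fun _ => hp.choose_spec⟩
      · exact ⟨1, fun h => absurd h hp⟩
    choose Y hY1 hY2 using e1
    choose g0 hg0 using e2
    refine ⟨S ∪ (⋃ u ∈ D, ⋃ w ∈ D, Y u w) ∪ g0 '' (D ×ˢ D ×ˢ D ×ˢ D), ?_, ?_, ?_, ?_⟩
    · exact (hS.union (hDfin.biUnion fun u _ => hDfin.biUnion fun w _ => hY1 u w)).union
        ((hDfin.prod (hDfin.prod (hDfin.prod hDfin))).image _)
    · exact fun x hx => Or.inl (Or.inl hx)
    · intro u hu w hw huw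
      rw [← hY2 u w huw, Subgroup.closure_le]
      intro y hy
      refine Subgroup.subset_closure ⟨Or.inl (Or.inr ?_), Subgroup.subset_closure hy⟩
      exact Set.mem_biUnion hu (Set.mem_biUnion hw hy)
    · intro u hu w hw u' hu' w' hw' g hg1 hg2
      have := hg0 (u, w, u', w') ⟨g, hg1, hg2⟩
      exact ⟨g0 (u, w, u', w'), Or.inr ⟨_, ⟨hu, hw, hu', hw'⟩, rfl⟩, this⟩
  let LS : V → Set H := fun x => {y | ∃ u ∈ D, ∃ u' ∈ D, ∃ g ∈ Z, g • u = u' ∧ r u = x ∧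
    y = (h u')⁻¹ * g * h u}
  let L : V → Subgroup H := fun x => Subgroup.closure (LS x)
  have hLSfin : ∀ x, (LS x).Finite := by
    intro x
    refine ((hDfin.prod (hDfin.prod hZfin)).image
      (fun p : V × V × H => (h p.2.1)⁻¹ * p.2.2 * h p.1)).subset ?_
    rintro y ⟨u, hu, u', hu', g, hg, -, -, rfl⟩
    exact ⟨(u, u', g), ⟨hu, hu', hg⟩, rfl⟩
  have hLstab : ∀ x, L x ≤ MulAction.stabilizer H x := by
    intro x
    rw [Subgroup.closure_le]
    rintro y ⟨u, hu, u', hu', g, hg, rfl, rfl, rfl⟩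
    rw [SetLike.mem_coe, MulAction.mem_stabilizer_iff, mul_smul, mul_smul, hhu, inv_smul_eq_iff]
    conv_rhs => rw [← hr u g, hhu]
  have hLmem : ∀ u ∈ D, ∀ u' ∈ D, ∀ g ∈ Z, g • u = u' → (h u')⁻¹ * g * h u ∈ L (r u) :=
    fun u hu u' hu' g hg e => Subgroup.subset_closure ⟨u, hu, u', hu', g, hg, e, rfl, rfl⟩
  obtain ⟨M, _, _, ι, hK, π, hπι, hπh, hgen⟩ := exists_fp_cover L D hDfin h (r '' D)
    (hDfin.image r) (fun x _ => hvert x _ (hLstab x)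
      ((Subgroup.fg_iff _).2 ⟨LS x, rfl, hLSfin x⟩))
  let rel : V × V × V × V × H → Set M := fun p =>
    {x | p.2.2.2.2 • p.1 = p.2.2.1 ∧ p.2.2.2.2 • p.2.1 = p.2.2.2.1 ∧
      ∃ (a : L (r p.1)) (b : L (r p.2.1)), (a : H) = (h p.2.2.1)⁻¹ * p.2.2.2.2 * h p.1 ∧
        (b : H) = (h p.2.2.2.1)⁻¹ * p.2.2.2.2 * h p.2.1 ∧
        x = (hK p.2.2.1 * ι _ a * (hK p.1)⁻¹)⁻¹ * (hK p.2.2.2.1 * ι _ b * (hK p.2.1)⁻¹)}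
  let Rel : Set M := (⋃ p ∈ D ×ˢ D ×ˢ D ×ˢ D ×ˢ Z, rel p) ∪ (fun u => hK (r u)) '' D
  have hRelfin : Rel.Finite := by
    refine Set.Finite.union (Set.Finite.biUnion
      (hDfin.prod (hDfin.prod (hDfin.prod (hDfin.prod hZfin)))) fun p _ =>
        Set.Subsingleton.finite ?_) (hDfin.image _)
    rintro x ⟨-, -, a, b, ha, hb, rfl⟩ y ⟨-, -, a', b', ha', hb', rfl⟩
    obtain rfl : a = a' := Subtype.ext (ha.trans ha'.symm)
    obtain rfl : b = b' := Subtype.ext (hb.trans hb'.symm)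
    rfl
  let NC : Subgroup M := Subgroup.normalClosure Rel
  have hNC : NC ≤ π.ker := by
    refine Subgroup.normalClosure_le_normal ?_
    rintro x (hx | ⟨u, hu, rfl⟩)
    · simp only [Set.mem_iUnion] at hx
      obtain ⟨⟨u, w, u', w', g⟩, ⟨hu, hw, hu', hw', hg⟩, -, -, a, b, ha, hb, rfl⟩ := hx
      simp only [] at hu hw hu' hw' ha hb
      simp only [SetLike.mem_coe, MonoidHom.mem_ker, map_mul, map_inv, hπh u hu, hπh w hw,
        hπh u' hu', hπh w' hw', hπι _ (Set.mem_image_of_mem r hu),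
        hπι _ (Set.mem_image_of_mem r hw), ha, hb]
      group
    · simp only [SetLike.mem_coe, MonoidHom.mem_ker]
      rw [hπh _ (hrD u hu), hh1]
  have hKfp : Group.IsFinitelyPresented (M ⧸ NC) :=
    Group.IsFinitelyPresented.quotient NC ⟨Rel, hRelfin, rfl⟩
  let K := M ⧸ NC
  let q : M →* K := QuotientGroup.mk' NC
  let πK : K →* H := QuotientGroup.lift NC π hNC
  have hπq : ∀ m, πK (q m) = π m := fun m => rfl
  have hqRel : ∀ m ∈ Rel, q m = 1 := fun m hm =>
    (QuotientGroup.eq_one_iff m).2 (Subgroup.subset_normalClosure hm)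
  have hE1 : ∀ u ∈ D, ∀ w ∈ D, ∀ u' ∈ D, ∀ w' ∈ D, ∀ g ∈ Z, g • u = u' → g • w = w' →
      ∃ (a : L (r u)) (b : L (r w)), (a : H) = (h u')⁻¹ * g * h u ∧ (b : H) = (h w')⁻¹ * g * h w ∧
        q (hK u') * q (ι _ a) * (q (hK u))⁻¹ = q (hK w') * q (ι _ b) * (q (hK w))⁻¹ := by
    intro u hu w hw u' hu' w' hw' g hg e1 e2
    refine ⟨⟨_, hLmem u hu u' hu' g hg e1⟩, ⟨_, hLmem w hw w' hw' g hg e2⟩, rfl, rfl, ?_⟩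
    have := hqRel _ (Or.inl (Set.mem_biUnion (x := (u, w, u', w', g)) ⟨hu, hw, hu', hw', hg⟩
      ⟨e1, e2, ⟨_, hLmem u hu u' hu' g hg e1⟩, ⟨_, hLmem w hw w' hw' g hg e2⟩, rfl, rfl, rfl⟩))
    rw [map_mul, map_inv, inv_mul_eq_one] at this
    simpa only [map_mul, map_inv] using this
  have hE2 : ∀ u ∈ D, ∀ w ∈ D, adj u w → ∀ g : H, g • u = u → g • w = w →
      ∃ (a : L (r u)) (b : L (r w)), (a : H) = (h u)⁻¹ * g * h u ∧ (b : H) = (h w)⁻¹ * g * h w ∧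
        q (hK u) * q (ι _ a) * (q (hK u))⁻¹ = q (hK w) * q (ι _ b) * (q (hK w))⁻¹ := by
    intro u hu w hw huw g e1 e2
    have hg := hZ1 u hu w hw huw (show g ∈ _ from ⟨e1, e2⟩)
    clear e1 e2
    induction hg using Subgroup.closure_induction with
    | mem g hg => exact hE1 u hu w hw u hu w hw g hg.1 hg.2.1 hg.2.2
    | one => exact ⟨1, 1, by simp, by simp, by simp⟩
    | mul x y _ _ hx hy =>
      obtain ⟨a, b, ha, hb, hab⟩ := hx
      obtain ⟨a', b', ha', hb', hab'⟩ := hy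
      refine ⟨a * a', b * b', ?_, ?_, ?_⟩
      · rw [Subgroup.coe_mul, ha, ha']; group
      · rw [Subgroup.coe_mul, hb, hb']; group
      · have := congrArg₂ (· * ·) hab hab'
        simpa [mul_assoc] using this
    | inv x _ hx =>
      obtain ⟨a, b, ha, hb, hab⟩ := hx
      refine ⟨a⁻¹, b⁻¹, ?_, ?_, ?_⟩
      · rw [Subgroup.coe_inv, ha]; group
      · rw [Subgroup.coe_inv, hb]; group
      · have := congrArg (fun x => x⁻¹) hab
        simp only [mul_inv_rev] at this
        rw [inv_inv (q (hK u)), inv_inv (q (hK w))] at this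
        simpa [mul_assoc] using this
  have hE : ∀ u ∈ D, ∀ w ∈ D, ∀ u' ∈ D, ∀ w' ∈ D, adj u w → ∀ g : H, g • u = u' → g • w = w' →
      ∃ (a : L (r u)) (b : L (r w)), (a : H) = (h u')⁻¹ * g * h u ∧ (b : H) = (h w')⁻¹ * g * h w ∧
        q (hK u') * q (ι _ a) * (q (hK u))⁻¹ = q (hK w') * q (ι _ b) * (q (hK w))⁻¹ := by
    intro u hu w hw u' hu' w' hw' huw g e1 e2
    obtain ⟨g0, hg0, f1, f2⟩ := hZ2 u hu w hw u' hu' w' hw' g e1 e2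
    obtain ⟨a, b, ha, hb, hab⟩ := hE1 u hu w hw u' hu' w' hw' g0 hg0 f1 f2
    obtain ⟨a', b', ha', hb', hab'⟩ := hE2 u hu w hw huw (g0⁻¹ * g)
      (by rw [mul_smul, e1, inv_smul_eq_iff, f1]) (by rw [mul_smul, e2, inv_smul_eq_iff, f2])
    refine ⟨a * a', b * b', ?_, ?_, ?_⟩
    · rw [Subgroup.coe_mul, ha, ha']; group
    · rw [Subgroup.coe_mul, hb, hb']; group
    · have := congrArg₂ (· * ·) hab hab'
      simpa [mul_assoc] using this
  have hDc' : ∀ u : D, Relation.ReflTransGen (fun x y : D => adj x y) ⟨v0, hv0⟩ u := by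
    have : ∀ u, Relation.ReflTransGen (fun x y => adj x y ∧ x ∈ D ∧ y ∈ D) v0 u → ∀ hu : u ∈ D,
        Relation.ReflTransGen (fun x y : D => adj x y) ⟨v0, hv0⟩ ⟨u, hu⟩ := by
      intro u hu
      induction hu with
      | refl => intro _; exact Relation.ReflTransGen.refl
      | tail _ hyz ih => intro hz; exact (ih hyz.2.1).tail hyz.1
    exact fun u => this u (hDc u u.2) u.2
  have hinj : Function.Injective πK := by
    refine core (K := K) adj adj_symm adj_smul htree D v0 hv0 hDc' r h hrD (fun u _ => hrr u)
      (fun u _ => hhu u) hr L (fun x => q.comp (ι x)) (fun u => q (hK u)) πK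
      (fun u _ l hl => hLstab _ hl) ?_ ?_ ?_ hE ?_
    · intro u hu l
      exact hπι _ (Set.mem_image_of_mem r hu) l
    · intro u hu
      exact hπh u hu
    · intro u hu
      exact hqRel _ (Or.inr ⟨u, hu, rfl⟩)
    · rw [← top_le_iff, ← (MonoidHom.range_eq_top (f := q)).2 (QuotientGroup.mk'_surjective NC),
        MonoidHom.range_eq_map, ← hgen, MonoidHom.map_closure]
      refine Subgroup.closure_mono ?_
      rintro _ ⟨y, ⟨u, hu, rfl⟩ | hy, rfl⟩
      · exact Or.inl ⟨u, hu, rfl⟩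
      · simp only [Set.mem_iUnion] at hy
        obtain ⟨_, ⟨u, hu, rfl⟩, l, rfl⟩ := hy
        exact Or.inr (Set.mem_biUnion hu ⟨l, rfl⟩)
  have hsurj : Function.Surjective πK := by
    rw [← MonoidHom.range_eq_top, ← top_le_iff, ← hS', Subgroup.closure_le]
    intro s hs
    have hsD : s • v0 ∈ D := hSD ⟨s, hs, rfl⟩
    refine ⟨q (hK (s • v0) * ι _ ⟨_, hLmem v0 hv0 (s • v0) hsD s (hSZ hs) rfl⟩ * (hK v0)⁻¹), ?_⟩
    rw [hπq, map_mul, map_mul, map_inv, hπh _ hsD, hπh _ hv0, hπι _ (Set.mem_image_of_mem r hv0)]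
    group
  exact Group.IsFinitelyPresented.equiv (MulEquiv.ofBijective πK ⟨hinj, hsurj⟩)

theorem fg_of_embeds {H C Γ : Type*} [Group H] [Group C] [Group Γ] (f : H →* Γ)
    (hf : Function.Injective f) (j : C →* Γ) (hC : ∀ K : Subgroup C, K.FG) (W : Subgroup H)
    (hW : ∀ x ∈ W, f x ∈ j.range) : W.FG := by
  have h1 : ((W.map f).comap j).map j = W.map f := by
    rw [Subgroup.map_comap_eq, inf_eq_right]
    rintro _ ⟨x, hx, rfl⟩
    exact hW x hx
  have h2 : (W.map f).FG := by
    rw [← h1, ← Group.fg_iff_subgroup_fg]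
    have : Group.FG ((W.map f).comap j) := (Group.fg_iff_subgroup_fg _).2 (hC _)
    exact Group.fg_of_surjective (MonoidHom.subgroupMap_surjective j _)
  rw [← Group.fg_iff_subgroup_fg] at h2 ⊢
  exact Group.fg_of_surjective (f := (W.equivMapOfInjective f hf).symm.toMonoidHom)
    (W.equivMapOfInjective f hf).symm.surjective

theorem isFP_of {G : Type*} [Group G] (h : Group.FinitelyPresented G) :
    Group.IsFinitelyPresented G := by
  obtain ⟨n, rels, ⟨e⟩⟩ := h
  exact Group.IsFinitelyPresented.equiv e.symm

theorem of_isFP {G : Type*} [Group G] (h : Group.IsFinitelyPresented G) :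
    Group.FinitelyPresented G := by
  obtain ⟨n, s, hs, e⟩ := Group.IsFinitelyPresented.exists_mulEquiv_presentedGroup (G := G)
  refine ⟨n, hs.toFinset, ?_⟩
  rw [hs.coe_toFinset]
  exact e

theorem fp_of_embeds {H G Γ : Type*} [Group H] [Group G] [Group Γ] (f : H →* Γ)
    (hf : Function.Injective f) (j : G →* Γ) (hj : Function.Injective j) (hG : Group.Coherent G)
    (L : Subgroup H) (hL : ∀ x ∈ L, f x ∈ j.range) (hfg : L.FG) :
    Group.IsFinitelyPresented L := by
  have h1 : ((L.map f).comap j).map j = L.map f := by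
    rw [Subgroup.map_comap_eq, inf_eq_right]
    rintro _ ⟨x, hx, rfl⟩
    exact hL x hx
  let e : ((L.map f).comap j) ≃* L :=
    (((L.map f).comap j).equivMapOfInjective j hj).trans
      ((MulEquiv.subgroupCongr h1).trans (L.equivMapOfInjective f hf).symm)
  have h2 : ((L.map f).comap j).FG := by
    rw [← Group.fg_iff_subgroup_fg] at hfg ⊢
    exact Group.fg_of_surjective (f := e.symm.toMonoidHom) e.symm.surjective
  have := isFP_of (hG _ h2)
  exact Group.IsFinitelyPresented.equiv e

section BassSerre

open HNNExtension

variable {G : Type u} [Group G] {A B : Subgroup G} {φ : A ≃* B}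

/-- Vertices of the Bass–Serre tree. -/
abbrev Vert (φ : A ≃* B) : Type u :=
  HNNExtension G A B φ ⧸ (of : G →* HNNExtension G A B φ).range

/-- The vertex given by an element. -/
abbrev vmk (γ : HNNExtension G A B φ) : Vert φ := QuotientGroup.mk γ

/-- Adjacency in the Bass–Serre tree. -/
def bsAdj (φ : A ≃* B) (x y : Vert φ) : Prop :=
  ∃ (γ : HNNExtension G A B φ) (v : ℤˣ), x = vmk γ ∧ y = vmk (γ * t ^ (v : ℤ))

theorem bsAdj_symm (x y : Vert φ) (h : bsAdj φ x y) : bsAdj φ y x := by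
  obtain ⟨γ, v, rfl, rfl⟩ := h
  exact ⟨γ * t ^ (v : ℤ), -v, rfl, by simp [mul_assoc]⟩

theorem bsAdj_smul (g : HNNExtension G A B φ) (x y : Vert φ) (h : bsAdj φ x y) :
    bsAdj φ (g • x) (g • y) := by
  obtain ⟨γ, v, rfl, rfl⟩ := h
  exact ⟨g * γ, v, rfl, by rw [mul_assoc]; rfl⟩

theorem rtg_symm {V : Type*} {adj : V → V → Prop} (hs : ∀ x y, adj x y → adj y x) {x y : V}
    (h : Relation.ReflTransGen adj x y) : Relation.ReflTransGen adj y x := by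
  induction h with
  | refl => exact Relation.ReflTransGen.refl
  | tail _ h ih => exact Relation.ReflTransGen.head (hs _ _ h) ih

theorem bs_conn (x : Vert φ) : Relation.ReflTransGen (bsAdj φ) (vmk 1) x := by
  obtain ⟨γ, rfl⟩ := QuotientGroup.mk_surjective x
  have tr : ∀ (g : HNNExtension G A B φ) (x y : Vert φ), Relation.ReflTransGen (bsAdj φ) x y →
      Relation.ReflTransGen (bsAdj φ) (g • x) (g • y) := by
    intro g x y h
    induction h with
    | refl => exact Relation.ReflTransGen.refl
    | tail _ h ih => exact ih.tail (bsAdj_smul g _ _ h)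
  induction γ using HNNExtension.induction_on with
  | of g =>
    have : vmk (of g : HNNExtension G A B φ) = vmk 1 := by
      rw [eq_comm, QuotientGroup.eq]; simp
    rw [← vmk, this]
  | t => exact Relation.ReflTransGen.single ⟨1, 1, rfl, by simp⟩
  | mul x y hx hy =>
    refine hx.trans ?_
    have := tr x _ _ hy
    rwa [MulAction.Quotient.smul_mk, MulAction.Quotient.smul_mk, smul_eq_mul, smul_eq_mul,
      mul_one] at this
  | inv x hx =>
    have := tr x⁻¹ _ _ (rtg_symm bsAdj_symm hx)
    rwa [MulAction.Quotient.smul_mk, MulAction.Quotient.smul_mk, smul_eq_mul, smul_eq_mul,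
      mul_one, inv_mul_cancel] at this

theorem of_mul_t_pow (v : ℤˣ) (c : G) (hc : c ∈ toSubgroup A B (-v)) :
    ∃ c' : G, (of c : HNNExtension G A B φ) * t ^ (v : ℤ) = t ^ (v : ℤ) * of c' := by
  rcases Int.units_eq_one_or v with rfl | rfl
  · refine ⟨φ.symm ⟨c, hc⟩, ?_⟩
    simpa using of_mul_t (φ := φ) ⟨c, hc⟩
  · rw [neg_neg] at hc
    refine ⟨φ ⟨c, hc⟩, ?_⟩
    simpa using of_mul_inv_t (φ := φ) ⟨c, hc⟩

/-- The word of a list. -/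
def wd (φ : A ≃* B) (l : List (ℤˣ × G)) : HNNExtension G A B φ :=
  (l.map (fun x => t ^ (x.1 : ℤ) * of x.2)).prod

theorem britton (l : List (ℤˣ × G))
    (hl : l.IsChain (fun a b => a.2 ∈ toSubgroup A B a.1 → a.1 = b.1))
    (h : wd φ l ∈ (of : G →* HNNExtension G A B φ).range) : l = [] :=
  ReducedWord.toList_eq_nil_of_mem_of_range φ ⟨1, l, hl⟩
    (by simpa [NormalWord.ReducedWord.prod, wd] using h)

theorem red_word {x0 x y : Vert φ} (h : Red (bsAdj φ) x0 x y) :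
    ∃ (γ : HNNExtension G A B φ) (v : ℤˣ) (g : G) (l : List (ℤˣ × G)),
      ((v, g) :: l).IsChain (fun a b => a.2 ∈ toSubgroup A B a.1 → a.1 = b.1) ∧
      y = vmk γ ∧ x = vmk (γ * t ^ (v : ℤ)) ∧ x0 = vmk (γ * wd φ ((v, g) :: l)) := by
  induction h with
  | start y h =>
    obtain ⟨γ, v, rfl, rfl⟩ := h
    exact ⟨γ * t ^ (v : ℤ), -v, 1, [], List.isChain_singleton _, rfl, by simp [mul_assoc],
      by simp [mul_assoc, wd]⟩
  | step x y z h hyz hne ih =>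
    obtain ⟨γ, u, g, l, hl, rfl, rfl, rfl⟩ := ih
    obtain ⟨γ', v, h1, rfl⟩ := hyz
    obtain ⟨c, hc⟩ := QuotientGroup.eq.1 h1
    obtain rfl : γ' = γ * of c := by rw [hc]; group
    refine ⟨γ * of c * t ^ (v : ℤ), -v, c⁻¹, (u, g) :: l, ?_, rfl, ?_, ?_⟩
    · refine List.isChain_cons_cons.2 ⟨fun hmem => ?_, hl⟩
      by_contra hvu
      simp only [inv_mem_iff] at hmem hvu
      have huv : u = v := by
        have hvu' : u ≠ -v := fun e => hvu e.symm
        rcases Int.units_eq_one_or v with rfl | rfl <;>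
          rcases Int.units_eq_one_or u with rfl | rfl
        · rfl
        · exact absurd rfl hvu'
        · exact absurd (neg_neg _).symm hvu'
        · rfl
      subst huv
      obtain ⟨c', hc'⟩ := of_mul_t_pow (φ := φ) u c hmem
      apply hne
      rw [mul_assoc, hc', eq_comm, QuotientGroup.eq]
      exact ⟨c', by group⟩
    · rw [h1]; simp [mul_assoc]
    · simp [mul_assoc, wd]

theorem bs_tree (x0 x y : Vert φ) (h : Red (bsAdj φ) x0 x y) : y ≠ x0 := by
  obtain ⟨γ, v, g, l, hl, rfl, -, rfl⟩ := red_word h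
  intro e
  have := britton (φ := φ) _ hl (by simpa using QuotientGroup.eq.1 e)
  simp at this

theorem mem_toSubgroup_of (v : ℤˣ) (c : G)
    (h : (t ^ (v : ℤ))⁻¹ * of c * t ^ (v : ℤ) ∈ (of : G →* HNNExtension G A B φ).range) :
    c ∈ toSubgroup A B (-v) := by
  by_contra hc
  have := britton (φ := φ) [(-v, c), (v, 1)] (by simp [hc]) (by simpa [wd, mul_assoc] using h)
  simp at this

theorem mem_stab_vmk (g γ : HNNExtension G A B φ) :
    g • vmk γ = vmk γ ↔ γ⁻¹ * g * γ ∈ (of : G →* HNNExtension G A B φ).range := by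
  rw [eq_comm, MulAction.Quotient.smul_mk, QuotientGroup.eq, smul_eq_mul, mul_assoc]

end BassSerre

theorem main {G : Type u} [Group G] (A B : Subgroup G) (φ : A ≃* B)
    (hG : Group.Coherent G) (hA : ∀ K : Subgroup ↥A, K.FG) :
    Group.Coherent (HNNExtension G A B φ) := by
  intro H hH
  apply of_isFP
  have hB : ∀ K : Subgroup B, K.FG := fun K =>
    fg_of_embeds φ.symm.toMonoidHom φ.symm.injective (MonoidHom.id A) hA K
      (fun x _ => ⟨φ.symm x, rfl⟩)
  have hAB : ∀ v : ℤˣ, ∀ K : Subgroup (HNNExtension.toSubgroup A B v), K.FG := by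
    intro v
    rcases Int.units_eq_one_or v with rfl | rfl
    · exact hA
    · exact hB
  obtain ⟨S, hS1, hS2⟩ := Group.fg_iff.1 ((Group.fg_iff_subgroup_fg H).2 hH)
  let cj : HNNExtension G A B φ → H →* HNNExtension G A B φ := fun γ =>
    (MulAut.conj γ⁻¹).toMonoidHom.comp H.subtype
  have hcj : ∀ γ, Function.Injective (cj γ) := fun γ =>
    (MulAut.conj γ⁻¹).injective.comp H.subtype_injective
  have hcj' : ∀ γ (x : H), cj γ x = γ⁻¹ * x * γ := fun γ x => by simp [cj]
  refine fp_of_tree (H := H) (V := Vert φ) (bsAdj φ) bsAdj_symm (fun g => bsAdj_smul (g : HNNExtension G A B φ))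
    bs_tree (vmk 1) bs_conn ?_ ?_ S hS2 hS1
  · intro v L hL hfg
    obtain ⟨γ, rfl⟩ := QuotientGroup.mk_surjective v
    refine fp_of_embeds (cj γ) (hcj γ) HNNExtension.of (HNNExtension.of_injective φ) hG L ?_ hfg
    intro x hx
    rw [hcj']
    exact (mem_stab_vmk _ _).1 (hL hx)
  · intro u w huw
    obtain ⟨γ, v, rfl, rfl⟩ := huw
    refine fg_of_embeds (cj γ) (hcj γ)
      (HNNExtension.of.comp (HNNExtension.toSubgroup A B (-v)).subtype) (hAB (-v)) _ ?_
    rintro x ⟨hx1, hx2⟩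
    obtain ⟨c, hc⟩ := (mem_stab_vmk _ _).1 hx1
    have h2 := (mem_stab_vmk _ _).1 hx2
    refine ⟨⟨c, mem_toSubgroup_of (φ := φ) v c ?_⟩, ?_⟩
    · rw [hc]
      simpa [mul_assoc] using h2
    · rw [hcj']; exact hc

end HNNCoh

/-- An HNN extension of a coherent group over a Noetherian associated subgroup is
coherent: if `G` is coherent, `A, B ≤ G`, `φ : A ≃ B` is an isomorphism, and every
subgroup of `A` is finitely generated, then the HNN extension `G*_φ` is coherent. -/
theorem coherent_HNNExtension {G : Type*} [Group G] (A B : Subgroup G) (φ : A ≃* B)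
    (hG : Group.Coherent G) (hA : ∀ K : Subgroup ↥A, K.FG) :
    Group.Coherent (HNNExtension G A B φ) := by
  exact HNNCoh.main A B φ hG hA
end

section
/- Let R be a nontrivial ring, let n, m ∈ ℕ with n < m, and let 1 → N → G → Q → 1 be a group extension, i.e., a surjective group homomorphism p : G → Q with kernel N. If every subgroup of Q of type FP_n(R) is of type FP_m(R), and every subgroup of N is of type FP_m(R), then every subgroup of G of type FP_n(R) is of type FP_m(R). (This is the homological analogue, over R, of part (i) of the extension inheritance lemma: if Q is homologically (n,m)-coherent over R and N is homologically (0,m)-coherent over R, then G is homologically (n,m)-coherent over R.) -/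
universe u v w

/-- The augmentation ring homomorphism `R[G] → R`, sending every group element to `1`. -/
noncomputable def augmentation (R : Type u) [Ring R] (G : Type v) [Group G] :
    MonoidAlgebra R G →+* R :=
  MonoidAlgebra.liftNCRingHom (RingHom.id R) (1 : G →* R)
    (fun x y => by simp)

/-- `R` as a module over the group ring `R[G]`, with the trivial `G`-action. -/
noncomputable instance trivialGroupRingModule (R : Type u) [Ring R] (G : Type v) [Group G] :
    Module (MonoidAlgebra R G) R :=
  Module.compHom R (augmentation R G)

/-- A witness that a group `G` is of type `FP_n(R)`: an exact sequence
`P_n → P_{n-1} → ⋯ → P_1 → P_0 → R → 0` of left `R[G]`-modules (with `R` carrying the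
trivial `G`-action) in which each `P_i`, `i ≤ n`, is a finitely generated projective
`R[G]`-module.  The family of modules and differentials is indexed by all of `ℕ`, but
only the data in degrees `≤ n` is constrained; exactness is required at `R` (i.e. the
augmentation `ε` is surjective), at `P_0` (when `n ≥ 1`), and at `P_i` for
`1 ≤ i ≤ n - 1`. -/
structure FPWitness (R : Type u) [Ring R] (G : Type v) [Group G] (n : ℕ) where
  P : ℕ → Type w
  [addCommGroup : ∀ i, AddCommGroup (P i)]
  [module : ∀ i, Module (MonoidAlgebra R G) (P i)]
  d : ∀ i, P (i + 1) →ₗ[MonoidAlgebra R G] P i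
  ε : P 0 →ₗ[MonoidAlgebra R G] R
  finite : ∀ i ≤ n, Module.Finite (MonoidAlgebra R G) (P i)
  projective : ∀ i ≤ n, Module.Projective (MonoidAlgebra R G) (P i)
  surjective : Function.Surjective ε
  exact_zero : 0 < n → LinearMap.range (d 0) = LinearMap.ker ε
  exact : ∀ i, i + 2 ≤ n → LinearMap.range (d (i + 1)) = LinearMap.ker (d i)

/-- A group `G` is of type `FP_n(R)` if there exists an exact sequence
`P_n → ⋯ → P_0 → R → 0` of left `R[G]`-modules in which each `P_i` is a finitely
generated projective `R[G]`-module and `R` carries the trivial `G`-action. -/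
def Group.IsTypeFP (R : Type u) [Ring R] (G : Type v) [Group G] (n : ℕ) : Prop :=
  Nonempty (FPWitness.{u, v, max u v} R G n)


/-! ### Modules of type `FP_k` -/

section ModuleFP

/-- Auxiliary: submodules of finitely generated free modules of type `FP_k`. -/
def SubFP (S : Type u) [Ring S] : ℕ → ∀ r : ℕ, Submodule S (Fin r → S) → Prop
  | 0, _, U => Module.Finite S U
  | k + 1, _, U => ∃ (s : ℕ) (f : (Fin s → S) →ₗ[S] U), Function.Surjective f ∧
      SubFP S k s (LinearMap.ker f)

/-- Modules of type `FP_k`. -/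
def ModFP (S : Type u) [Ring S] (k : ℕ) (M : Type v) [AddCommGroup M] [Module S M] : Prop :=
  match k with
  | 0 => Module.Finite S M
  | k + 1 => ∃ (s : ℕ) (f : (Fin s → S) →ₗ[S] M), Function.Surjective f ∧
      SubFP S k s (LinearMap.ker f)

theorem subFP_iff {S : Type u} [Ring S] (k r : ℕ) (U : Submodule S (Fin r → S)) :
    SubFP S k r U ↔ ModFP S k U := by
  cases k <;> rfl

theorem modFP_zero {S : Type u} [Ring S] {M : Type v} [AddCommGroup M] [Module S M] :
    ModFP S 0 M ↔ Module.Finite S M := Iff.rfl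

theorem modFP_succ {S : Type u} [Ring S] {k : ℕ} {M : Type v} [AddCommGroup M] [Module S M] :
    ModFP S (k + 1) M ↔ ∃ (s : ℕ) (f : (Fin s → S) →ₗ[S] M), Function.Surjective f ∧
      ModFP S k (LinearMap.ker f) := by
  simp only [← subFP_iff]; rfl

variable {S : Type u} [Ring S]

theorem ModFP.of_equiv {k : ℕ} {M : Type v} [AddCommGroup M] [Module S M]
    {M' : Type w} [AddCommGroup M'] [Module S M'] (e : M ≃ₗ[S] M') (h : ModFP S k M) :
    ModFP S k M' := by
  cases k with
  | zero =>
    have : Module.Finite S M := h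
    exact Module.Finite.equiv e
  | succ k =>
    rw [modFP_succ] at h ⊢
    obtain ⟨s, f, hf, hk⟩ := h
    refine ⟨s, e.toLinearMap ∘ₗ f, e.surjective.comp hf, ?_⟩
    rwa [LinearEquiv.ker_comp]

theorem ModFP.finite {k : ℕ} {M : Type v} [AddCommGroup M] [Module S M] (h : ModFP S k M) :
    Module.Finite S M := by
  cases k with
  | zero => exact h
  | succ k =>
    rw [modFP_succ] at h
    obtain ⟨s, f, hf, hk⟩ := h
    exact Module.Finite.of_surjective f hf

/-- The equivalence `S^(a+b) ≃ S^a × S^b`. -/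
def finSplit (S : Type u) [Ring S] (a b : ℕ) :
    (Fin (a + b) → S) ≃ₗ[S] (Fin a → S) × (Fin b → S) :=
  (LinearEquiv.funCongrLeft S S finSumFinEquiv).trans
    (LinearEquiv.sumArrowLequivProdArrow (Fin a) (Fin b) S S)

theorem ModFP.ext_step {k : ℕ}
    (ih : ∀ {A B C : Type u} [AddCommGroup A] [AddCommGroup B] [AddCommGroup C]
      [Module S A] [Module S B] [Module S C] (i : A →ₗ[S] B) (q : B →ₗ[S] C),
      Function.Injective i → Function.Exact i q → Function.Surjective q →
      ModFP S k A → ModFP S k C → ModFP S k B)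
    {A : Type*} {B : Type*} {C : Type*} [AddCommGroup A] [AddCommGroup B] [AddCommGroup C]
    [Module S A] [Module S B] [Module S C] (i : A →ₗ[S] B) (q : B →ₗ[S] C)
    (hi : Function.Injective i) (hiq : Function.Exact i q) (hq : Function.Surjective q)
    (hA : ModFP S (k + 1) A) (hC : ModFP S (k + 1) C) : ModFP S (k + 1) B := by
  rw [modFP_succ] at hA hC ⊢
  obtain ⟨a, f, hf, hfk⟩ := hA
  obtain ⟨c, g, hg, hgk⟩ := hC
  obtain ⟨l, hl⟩ := Module.projective_lifting_property q g hq
  have hl' : ∀ y, q (l y) = g y := fun y => LinearMap.congr_fun hl y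
  have hqi : ∀ x, q (i x) = 0 := fun x => hiq.apply_apply_eq_zero x
  let e := finSplit S a c
  let Φ : (Fin (a + c) → S) →ₗ[S] B := (LinearMap.coprod (i ∘ₗ f) l) ∘ₗ e.toLinearMap
  have hΦ : ∀ w, Φ w = i (f (e w).1) + l (e w).2 := fun w => rfl
  refine ⟨a + c, Φ, ?_, ?_⟩
  · intro b
    obtain ⟨y, hy⟩ := hg (q b)
    obtain ⟨x', hx'⟩ := (hiq (b - l y)).1 (by rw [map_sub, hl', hy, sub_self])
    obtain ⟨x, rfl⟩ := hf x'
    refine ⟨e.symm (x, y), ?_⟩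
    rw [hΦ, e.apply_symm_apply, hx']; simp
  · let i' : LinearMap.ker f →ₗ[S] LinearMap.ker Φ :=
      LinearMap.codRestrict _ (e.symm.toLinearMap ∘ₗ LinearMap.inl S _ _ ∘ₗ
        (LinearMap.ker f).subtype) (by
          rintro ⟨x, hx⟩
          rw [LinearMap.mem_ker] at hx
          simp [hΦ, hx])
    let q' : LinearMap.ker Φ →ₗ[S] LinearMap.ker g :=
      LinearMap.codRestrict _ (LinearMap.snd S _ _ ∘ₗ e.toLinearMap ∘ₗ
        (LinearMap.ker Φ).subtype) (by
          rintro ⟨x, hx⟩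
          rw [LinearMap.mem_ker, hΦ] at hx
          have := congrArg q hx
          rw [map_add, hqi, hl', map_zero, zero_add] at this
          simpa using this)
    have hi' : ∀ x, (i' x : Fin (a + c) → S) = e.symm (x.1, 0) := fun x => rfl
    have hq' : ∀ x, (q' x : Fin c → S) = (e x.1).2 := fun x => rfl
    refine ih i' q' ?_ ?_ ?_ hfk hgk
    · intro x y hxy
      have := congrArg (fun z => (e z.1).1) hxy
      simp only [hi', e.apply_symm_apply] at this
      exact Subtype.ext this
    · intro w
      constructor
      · intro hw
        have h2 : (e w.1).2 = 0 := by rw [← hq', hw]; rfl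
        have h1 : Φ w.1 = 0 := w.2
        rw [hΦ, h2, map_zero, add_zero, ← map_zero i] at h1
        refine ⟨⟨(e w.1).1, hi h1⟩, Subtype.ext ?_⟩
        rw [hi']
        apply e.injective
        rw [e.apply_symm_apply]
        exact Prod.ext rfl h2.symm
      · rintro ⟨x, rfl⟩
        apply Subtype.ext
        rw [hq', hi', e.apply_symm_apply]; rfl
    · rintro ⟨y, hy⟩
      rw [LinearMap.mem_ker] at hy
      obtain ⟨x', hx'⟩ := (hiq (-l y)).1 (by rw [map_neg, hl', hy, neg_zero])
      obtain ⟨x, rfl⟩ := hf x'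
      refine ⟨⟨e.symm (x, y), ?_⟩, Subtype.ext ?_⟩
      · rw [LinearMap.mem_ker, hΦ, e.apply_symm_apply, hx']; simp
      · rw [hq', e.apply_symm_apply]

theorem ModFP.ext_zero
    {A : Type*} {B : Type*} {C : Type*} [AddCommGroup A] [AddCommGroup B] [AddCommGroup C]
    [Module S A] [Module S B] [Module S C] (i : A →ₗ[S] B) (q : B →ₗ[S] C)
    (hiq : Function.Exact i q) (hq : Function.Surjective q)
    (hA : ModFP S 0 A) (hC : ModFP S 0 C) : ModFP S 0 B := by
  rw [modFP_zero] at hA hC ⊢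
  have h1 : (LinearMap.ker q).FG := by
    rw [LinearMap.exact_iff.1 hiq]
    exact Module.Finite.iff_fg.1 inferInstance
  refine ⟨Submodule.fg_of_fg_map_of_fg_inf_ker q ?_ ?_⟩
  · rw [Submodule.map_top, LinearMap.range_eq_top.2 hq]; exact hC.1
  · rwa [top_inf_eq]

theorem ModFP.ext_aux (k : ℕ) :
    ∀ {A B C : Type u} [AddCommGroup A] [AddCommGroup B] [AddCommGroup C]
      [Module S A] [Module S B] [Module S C] (i : A →ₗ[S] B) (q : B →ₗ[S] C),
      Function.Injective i → Function.Exact i q → Function.Surjective q →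
      ModFP S k A → ModFP S k C → ModFP S k B := by
  induction k with
  | zero => intro A B C _ _ _ _ _ _ i q _ h1 h2 h3 h4; exact ModFP.ext_zero i q h1 h2 h3 h4
  | succ k ih => intro A B C _ _ _ _ _ _ i q; exact ModFP.ext_step ih i q

/-- Extensions of modules of type `FP_k` are of type `FP_k`. -/
theorem ModFP.ext {k : ℕ}
    {A : Type*} {B : Type*} {C : Type*} [AddCommGroup A] [AddCommGroup B] [AddCommGroup C]
    [Module S A] [Module S B] [Module S C] (i : A →ₗ[S] B) (q : B →ₗ[S] C)
    (hi : Function.Injective i) (hiq : Function.Exact i q) (hq : Function.Surjective q)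
    (hA : ModFP S k A) (hC : ModFP S k C) : ModFP S k B := by
  cases k with
  | zero => exact ModFP.ext_zero i q hiq hq hA hC
  | succ k => exact ModFP.ext_step (ModFP.ext_aux k) i q hi hiq hq hA hC

theorem ModFP.prod {k : ℕ} {A : Type*} {B : Type*} [AddCommGroup A] [AddCommGroup B]
    [Module S A] [Module S B] (hA : ModFP S k A) (hB : ModFP S k B) : ModFP S k (A × B) :=
  ModFP.ext (LinearMap.inl S A B) (LinearMap.snd S A B) LinearMap.inl_injective
    Function.Exact.inl_snd Prod.snd_surjective hA hB

/-- Quotient of `FP_{k+1}` by `FP_k` is `FP_{k+1}`. -/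
theorem ModFP.quot {k : ℕ} {B : Type*} {C : Type*} [AddCommGroup B] [AddCommGroup C]
    [Module S B] [Module S C] (q : B →ₗ[S] C) (hq : Function.Surjective q)
    (hA : ModFP S k (LinearMap.ker q)) (hB : ModFP S (k + 1) B) : ModFP S (k + 1) C := by
  rw [modFP_succ] at hB ⊢
  obtain ⟨r, f, hf, hfk⟩ := hB
  refine ⟨r, q ∘ₗ f, hq.comp hf, ?_⟩
  let i' : LinearMap.ker f →ₗ[S] LinearMap.ker (q ∘ₗ f) :=
    Submodule.inclusion (LinearMap.ker_le_ker_comp f q)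
  let q' : LinearMap.ker (q ∘ₗ f) →ₗ[S] LinearMap.ker q :=
    LinearMap.codRestrict _ (f ∘ₗ (LinearMap.ker (q ∘ₗ f)).subtype) (fun x => x.2)
  refine ModFP.ext i' q' (Submodule.inclusion_injective _) ?_ ?_ hfk hA
  · intro y
    constructor
    · intro hy
      exact ⟨⟨y.1, congrArg Subtype.val hy⟩, rfl⟩
    · rintro ⟨x, rfl⟩
      exact Subtype.ext x.2
  · rintro ⟨b, hb⟩
    obtain ⟨x, rfl⟩ := hf b
    exact ⟨⟨x, hb⟩, rfl⟩

theorem ModFP.of_subsingleton_aux (k : ℕ) : ∀ (M : Type u) [AddCommGroup M] [Module S M]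
    [Subsingleton M], ModFP S k M := by
  induction k with
  | zero => intro M _ _ _; rw [modFP_zero]; infer_instance
  | succ k ih =>
    intro M _ _ _
    rw [modFP_succ]
    exact ⟨0, 0, fun x => ⟨0, Subsingleton.elim _ _⟩, ih _⟩

theorem ModFP.free (k r : ℕ) : ModFP S k (Fin r → S) := by
  cases k with
  | zero => rw [modFP_zero]; infer_instance
  | succ k =>
    rw [modFP_succ]
    refine ⟨r, LinearMap.id, Function.surjective_id, ?_⟩
    have : Subsingleton (LinearMap.ker (LinearMap.id : (Fin r → S) →ₗ[S] (Fin r → S))) := by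
      rw [LinearMap.ker_id]; infer_instance
    exact ModFP.of_subsingleton_aux k _

/-- Direct summands with free complement. -/
theorem ModFP.of_prod_free {k r : ℕ} {A : Type*} [AddCommGroup A] [Module S A]
    (h : ModFP S k (A × (Fin r → S))) : ModFP S k A := by
  cases k with
  | zero =>
    rw [modFP_zero] at h ⊢
    exact Module.Finite.of_surjective (LinearMap.fst S A (Fin r → S)) Prod.fst_surjective
  | succ k =>
    refine ModFP.quot (LinearMap.fst S A (Fin r → S)) Prod.fst_surjective ?_ h
    rw [LinearMap.ker_fst]
    exact ModFP.of_equiv (LinearEquiv.ofInjective (LinearMap.inr S A (Fin r → S))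
      LinearMap.inr_injective) (ModFP.free k r)

/-- Kernels of surjections from `FP_k` onto `FP_{k+1}` are `FP_k`. -/
theorem ModFP.ker {k : ℕ} {B : Type*} {C : Type*} [AddCommGroup B] [AddCommGroup C]
    [Module S B] [Module S C] (q : B →ₗ[S] C) (hq : Function.Surjective q)
    (hB : ModFP S k B) (hC : ModFP S (k + 1) C) : ModFP S k (LinearMap.ker q) := by
  rw [modFP_succ] at hC
  obtain ⟨r, f, hf, hfk⟩ := hC
  obtain ⟨l, hl⟩ := Module.projective_lifting_property q f hq
  have hl' : ∀ y, q (l y) = f y := fun y => LinearMap.congr_fun hl y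
  let Ψ : (LinearMap.ker q × (Fin r → S)) →ₗ[S] B :=
    LinearMap.coprod (LinearMap.ker q).subtype l
  have hΨ : ∀ x, Ψ x = x.1.1 + l x.2 := fun x => rfl
  let j : LinearMap.ker f →ₗ[S] LinearMap.ker q :=
    LinearMap.codRestrict _ (-(l ∘ₗ (LinearMap.ker f).subtype)) (by
      rintro ⟨x, hx⟩
      rw [LinearMap.mem_ker] at hx ⊢
      simp [hl', hx])
  have hj : ∀ x, (j x : B) = - l x.1 := fun x => rfl
  refine ModFP.of_prod_free (r := r) (ModFP.ext (LinearMap.prod j (LinearMap.ker f).subtype)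
    Ψ ?_ ?_ ?_ hfk hB)
  · intro x y hxy
    exact Subtype.ext (congrArg Prod.snd hxy)
  · intro x
    constructor
    · intro hx
      rw [hΨ] at hx
      have h2 : f x.2 = 0 := by
        have := congrArg q hx
        rw [map_add, hl', map_zero, show q x.1.1 = 0 from x.1.2, zero_add] at this
        exact this
      refine ⟨⟨x.2, h2⟩, Prod.ext (Subtype.ext ?_) rfl⟩
      change - l x.2 = x.1.1
      exact (eq_neg_of_add_eq_zero_left hx).symm
    · rintro ⟨y, rfl⟩
      rw [hΨ]
      change - l y.1 + l y.1 = 0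
      simp
  · intro b
    obtain ⟨y, hy⟩ := hf (q b)
    refine ⟨(⟨b - l y, ?_⟩, y), ?_⟩
    · rw [LinearMap.mem_ker, map_sub, hl', hy, sub_self]
    · rw [hΨ]; simp

theorem ModFP.proj_step {k : ℕ}
    (ih : ∀ (P : Type u) [AddCommGroup P] [Module S P] [Module.Finite S P]
      [Module.Projective S P], ModFP S k P)
    (P : Type*) [AddCommGroup P] [Module S P] [Module.Finite S P]
      [Module.Projective S P] : ModFP S (k + 1) P := by
  obtain ⟨r, f, hf⟩ := Module.Finite.exists_fin' S P
  obtain ⟨s, hs⟩ := Module.projective_lifting_property f LinearMap.id hf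
  have hs' : ∀ y, f (s y) = y := fun y => LinearMap.congr_fun hs y
  rw [modFP_succ]
  refine ⟨r, f, hf, ?_⟩
  let t : (Fin r → S) →ₗ[S] LinearMap.ker f :=
    LinearMap.codRestrict _ (LinearMap.id - s ∘ₗ f) (by
      intro x; rw [LinearMap.mem_ker]; simp [hs'])
  have ht : t ∘ₗ (LinearMap.ker f).subtype = LinearMap.id := by
    apply LinearMap.ext
    rintro ⟨x, hx⟩
    rw [LinearMap.mem_ker] at hx
    apply Subtype.ext
    change x - s (f x) = x
    rw [hx, map_zero, sub_zero]
  have : Module.Finite S (LinearMap.ker f) :=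
    Module.Finite.of_surjective t (fun y => ⟨y.1, LinearMap.congr_fun ht y⟩)
  have : Module.Projective S (LinearMap.ker f) := Module.Projective.of_split _ _ ht
  exact ih _

theorem ModFP.proj_aux (k : ℕ) : ∀ (P : Type u) [AddCommGroup P] [Module S P]
    [Module.Finite S P] [Module.Projective S P], ModFP S k P := by
  induction k with
  | zero => intro P _ _ h _; exact h
  | succ k ih => intro P _ _ _ _; exact ModFP.proj_step ih P

theorem ModFP.proj (k : ℕ) (P : Type*) [AddCommGroup P] [Module S P]
    [h : Module.Finite S P] [Module.Projective S P] : ModFP S k P := by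
  cases k with
  | zero => exact h
  | succ k => exact ModFP.proj_step (ModFP.proj_aux k) P

theorem ModFP.mono_succ_aux (k : ℕ) : ∀ (M : Type u) [AddCommGroup M] [Module S M],
    ModFP S (k + 1) M → ModFP S k M := by
  induction k with
  | zero => intro M _ _ h; exact h.finite
  | succ k ih =>
    intro M _ _ h
    rw [modFP_succ] at h ⊢
    obtain ⟨r, f, hf, hk⟩ := h
    exact ⟨r, f, hf, ih _ hk⟩

theorem ModFP.mono_succ {k : ℕ} {M : Type*} [AddCommGroup M] [Module S M]
    (h : ModFP S (k + 1) M) : ModFP S k M := by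
  cases k with
  | zero => exact h.finite
  | succ k =>
    rw [modFP_succ] at h ⊢
    obtain ⟨r, f, hf, hk⟩ := h
    exact ⟨r, f, hf, ModFP.mono_succ_aux _ _ hk⟩

theorem ModFP.mono {k l : ℕ} (hkl : k ≤ l) {M : Type*} [AddCommGroup M] [Module S M]
    (h : ModFP S l M) : ModFP S k M := by
  induction l, hkl using Nat.le_induction with
  | base => exact h
  | succ l _ ih => exact ih h.mono_succ

theorem ModFP.pow {k : ℕ} {M : Type*} [AddCommGroup M] [Module S M]
    (h : ModFP S k M) (r : ℕ) : ModFP S k (Fin r → M) := by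
  induction r with
  | zero =>
    exact ModFP.of_equiv (LinearEquiv.ofSubsingleton (Fin 0 → S) (Fin 0 → M)) (ModFP.free k 0)
  | succ r ih =>
    exact ModFP.of_equiv (Fin.consLinearEquiv S (fun _ : Fin (r + 1) => M)) (h.prod ih)

/-! ### Change of rings -/

variable {T : Type w} [Ring T] [Module S T] [IsScalarTower S T T]

theorem ModFP.restrict_step {k : ℕ} (hT : ModFP S (k + 1) T)
    (ih : ∀ (M : Type w) [AddCommGroup M] [Module T M] [Module S M] [IsScalarTower S T M],
      ModFP T k M → ModFP S k M)
    (M : Type*) [AddCommGroup M] [Module T M] [Module S M] [IsScalarTower S T M]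
    (h : ModFP T (k + 1) M) : ModFP S (k + 1) M := by
  rw [modFP_succ] at h
  obtain ⟨r, f, hf, hk⟩ := h
  exact ModFP.quot (f.restrictScalars S) hf (ih (LinearMap.ker f) hk) (hT.pow r)

theorem ModFP.restrict_zero (hT : ModFP S 0 T)
    (M : Type*) [AddCommGroup M] [Module T M] [Module S M] [IsScalarTower S T M]
    (h : ModFP T 0 M) : ModFP S 0 M := by
  rw [modFP_zero] at *
  exact Module.Finite.trans T M

theorem ModFP.restrict_aux (k : ℕ) (hT : ModFP S k T) :
    ∀ (M : Type w) [AddCommGroup M] [Module T M] [Module S M] [IsScalarTower S T M],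
      ModFP T k M → ModFP S k M := by
  induction k with
  | zero => intro M _ _ _ _; exact ModFP.restrict_zero hT M
  | succ k ih => intro M _ _ _ _; exact ModFP.restrict_step hT (ih hT.mono_succ) M

theorem ModFP.restrict {k : ℕ} (hT : ModFP S k T)
    (M : Type*) [AddCommGroup M] [Module T M] [Module S M] [IsScalarTower S T M]
    (h : ModFP T k M) : ModFP S k M := by
  cases k with
  | zero => exact ModFP.restrict_zero hT M h
  | succ k => exact ModFP.restrict_step hT (ModFP.restrict_aux k hT.mono_succ) M h

theorem ModFP.extend_zero
    (M : Type*) [AddCommGroup M] [Module T M] [Module S M] [IsScalarTower S T M]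
    (h : ModFP S 0 M) : ModFP T 0 M := by
  rw [modFP_zero] at *
  obtain ⟨r, g, hg⟩ := Module.Finite.exists_fin (R := S) (M := M)
  refine ⟨(Submodule.fg_def).2 ⟨Set.range g, Set.finite_range g, ?_⟩⟩
  rw [eq_top_iff]
  intro x _
  have hx : x ∈ Submodule.span S (Set.range g) := hg ▸ Submodule.mem_top
  exact Submodule.span_le_restrictScalars S T _ hx

theorem ModFP.extend_step {k : ℕ} (hT : ModFP S k T)
    (ih : ∀ (M : Type w) [AddCommGroup M] [Module T M] [Module S M] [IsScalarTower S T M],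
      ModFP S k M → ModFP T k M)
    (M : Type*) [AddCommGroup M] [Module T M] [Module S M] [IsScalarTower S T M]
    (h : ModFP S (k + 1) M) : ModFP T (k + 1) M := by
  have : Module.Finite T M := ModFP.extend_zero (S := S) (T := T) M h.finite
  obtain ⟨r, f, hf⟩ := Module.Finite.exists_fin' T M
  rw [modFP_succ]
  exact ⟨r, f, hf, ih (LinearMap.ker f) (ModFP.ker (f.restrictScalars S) hf (hT.pow r) h)⟩

theorem ModFP.extend_aux (k : ℕ) (hT : ModFP S k T) :
    ∀ (M : Type w) [AddCommGroup M] [Module T M] [Module S M] [IsScalarTower S T M],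
      ModFP S k M → ModFP T k M := by
  induction k with
  | zero => intro M _ _ _ _; exact ModFP.extend_zero M
  | succ k ih =>
    intro M _ _ _ _; exact ModFP.extend_step hT.mono_succ (ih hT.mono_succ) M

theorem ModFP.extend {k : ℕ} (hT : ModFP S k T)
    (M : Type*) [AddCommGroup M] [Module T M] [Module S M] [IsScalarTower S T M]
    (h : ModFP S k M) : ModFP T k M := by
  cases k with
  | zero => exact ModFP.extend_zero M h
  | succ k => exact ModFP.extend_step hT.mono_succ (ModFP.extend_aux k hT.mono_succ) M h

end ModuleFP

/-! ### Induced modules -/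

section Induction

/-- The map `⨁ h i • M0 → M`. -/
noncomputable def indMap {S : Type*} [Ring S] {I : Type*} (h : I → S) {M0 M : Type*}
    [AddCommGroup M0] [AddCommGroup M] [Module S M] (ι : M0 →+ M) : (I →₀ M0) →+ M :=
  Finsupp.liftAddHom (fun i => (DistribSMul.toAddMonoidHom M (h i)).comp ι)

theorem indMap_single {S : Type*} [Ring S] {I : Type*} (h : I → S) {M0 M : Type*}
    [AddCommGroup M0] [AddCommGroup M] [Module S M] (ι : M0 →+ M) (i : I) (x : M0) :
    indMap h ι (Finsupp.single i x) = h i • ι x := by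
  simp [indMap]

theorem indMap_nat {S : Type*} [Ring S] {I : Type*} (h : I → S) {M0 M M0' M' : Type*}
    [AddCommGroup M0] [AddCommGroup M] [Module S M]
    [AddCommGroup M0'] [AddCommGroup M'] [Module S M'] (ι : M0 →+ M) (ι' : M0' →+ M')
    (f : M0 →+ M0') (F : M →ₗ[S] M') (hf : ∀ x, F (ι x) = ι' (f x)) (g : I →₀ M0) :
    F (indMap h ι g) = indMap h ι' (Finsupp.mapRange.addMonoidHom f g) := by
  induction g using Finsupp.induction_linear with
  | zero => simp
  | add a b ha hb => simp only [map_add, ha, hb]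
  | single i x => simp [indMap_single, hf]

/-- `M` is the module induced from `M0`, relative to a right basis `h` of `S` over `S0`. -/
structure IsInd {S0 S : Type*} [Ring S0] [Ring S] (j : S0 →+* S) {I : Type*} (h : I → S)
    {M0 M : Type*} [AddCommGroup M0] [AddCommGroup M] [Module S0 M0] [Module S M]
    (ι : M0 →+ M) : Prop where
  smul : ∀ a m, ι (a • m) = j a • ι m
  surj : Function.Surjective (indMap h ι)
  uniq : ∀ g, indMap h ι g = 0 → g = 0

theorem IsInd.pow {S0 S : Type*} [Ring S0] [Ring S] {j : S0 →+* S} {I : Type*} {h : I → S}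
    {M0 M : Type*} [AddCommGroup M0] [AddCommGroup M] [Module S0 M0] [Module S M]
    {ι : M0 →+ M} (H : IsInd j h ι) (r : ℕ) : IsInd j h (ι.compLeft (Fin r)) := by
  have key : ∀ (g : I →₀ (Fin r → M0)) (t : Fin r), indMap h (ι.compLeft (Fin r)) g t =
      indMap h ι (Finsupp.mapRange.addMonoidHom (Pi.evalAddMonoidHom _ t) g) := fun g t =>
    indMap_nat h (ι.compLeft (Fin r)) ι (Pi.evalAddMonoidHom _ t)
      (LinearMap.proj (R := S) (φ := fun _ : Fin r => M) t) (fun x => rfl) g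
  refine ⟨?_, ?_, ?_⟩
  · intro a m
    funext t
    exact H.smul a (m t)
  · intro m
    choose g hg using fun t => H.surj (m t)
    refine ⟨∑ t, Finsupp.mapRange.addMonoidHom (AddMonoidHom.single (fun _ : Fin r => M0) t)
      (g t), ?_⟩
    funext t
    rw [key, ← hg t]
    congr 1
    ext i
    simp [Finsupp.finsetSum_apply, Pi.single_apply]
  · intro g hg
    ext i t
    have := H.uniq (Finsupp.mapRange.addMonoidHom (Pi.evalAddMonoidHom _ t) g) (by
      rw [← key, hg]; rfl)
    exact DFunLike.congr_fun this i

variable {S0 : Type u} {S : Type v} [Ring S0] [Ring S] {j : S0 →+* S} {I : Type*} {h : I → S}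

/-- The extension of a map from a free module. -/
noncomputable def indExt (S0 : Type u) [Ring S0] (S : Type v) [Ring S]
    {M0 M : Type*} [AddCommGroup M0] [AddCommGroup M]
    [Module S0 M0] [Module S M] (ι : M0 →+ M) {r : ℕ} (f : (Fin r → S0) →ₗ[S0] M0) :
    (Fin r → S) →ₗ[S] M :=
  Fintype.linearCombination S (fun t => ι (f (Pi.single t 1)))

theorem indExt_apply {M0 M : Type*} [AddCommGroup M0] [AddCommGroup M]
    [Module S0 M0] [Module S M] {ι : M0 →+ M} (H : IsInd j h ι) {r : ℕ}
    (f : (Fin r → S0) →ₗ[S0] M0) (x : Fin r → S0) :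
    indExt S0 S ι f (j.toAddMonoidHom.compLeft (Fin r) x) = ι (f x) := by
  rw [indExt, Fintype.linearCombination_apply]
  conv_rhs => rw [← Finset.univ_sum_single x]
  rw [map_sum, map_sum]
  refine Finset.sum_congr rfl fun t _ => ?_
  have : Pi.single t (x t) = x t • (Pi.single t 1 : Fin r → S0) := by
    rw [← Pi.single_smul, smul_eq_mul, mul_one]
  rw [this, map_smul, H.smul]; rfl

theorem indExt_surj {M0 M : Type*} [AddCommGroup M0] [AddCommGroup M]
    [Module S0 M0] [Module S M] {ι : M0 →+ M} (H : IsInd j h ι) {r : ℕ}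
    (f : (Fin r → S0) →ₗ[S0] M0) (hf : Function.Surjective f) :
    Function.Surjective (indExt S0 S ι f) := by
  intro m
  obtain ⟨g, rfl⟩ := H.surj m
  change indMap h ι g ∈ LinearMap.range (indExt S0 S ι f)
  induction g using Finsupp.induction_linear with
  | zero => simp
  | add a b ha hb => rw [map_add]; exact Submodule.add_mem _ ha hb
  | single i x =>
    rw [indMap_single]
    obtain ⟨y, rfl⟩ := hf x
    exact Submodule.smul_mem _ _ ⟨_, indExt_apply H f y⟩

theorem IsInd.modFP_step (hR : IsInd j h j.toAddMonoidHom) {k : ℕ}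
    (ih : ∀ {M0 : Type u} {M : Type v} [AddCommGroup M0] [AddCommGroup M]
      [Module S0 M0] [Module S M] {ι : M0 →+ M}, IsInd j h ι → ModFP S0 k M0 → ModFP S k M)
    {M0 M : Type*} [AddCommGroup M0] [AddCommGroup M]
    [Module S0 M0] [Module S M] {ι : M0 →+ M} (H : IsInd j h ι)
    (hM : ModFP S0 (k + 1) M0) : ModFP S (k + 1) M := by
  rw [modFP_succ] at hM ⊢
  obtain ⟨r, f, hf, hk⟩ := hM
  refine ⟨r, indExt S0 S ι f, indExt_surj H f hf, ?_⟩
  let ιr := j.toAddMonoidHom.compLeft (Fin r)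
  have Hr : IsInd j h ιr := hR.pow r
  let ι' : LinearMap.ker f →+ LinearMap.ker (indExt S0 S ι f) :=
    { toFun := fun x => ⟨ιr x.1, by
        rw [LinearMap.mem_ker, indExt_apply H, show f x.1 = 0 from x.2, map_zero]⟩
      map_zero' := Subtype.ext (map_zero ιr)
      map_add' := fun x y => Subtype.ext (map_add ιr x.1 y.1) }
  have key : ∀ g : I →₀ LinearMap.ker f, (indMap h ι' g).1 = indMap h ιr
      (Finsupp.mapRange.addMonoidHom (LinearMap.ker f).subtype.toAddMonoidHom g) := fun g =>
    indMap_nat h ι' ιr (LinearMap.ker f).subtype.toAddMonoidHom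
      (LinearMap.ker (indExt S0 S ι f)).subtype (fun x => rfl) g
  refine ih (ι := ι') ⟨?_, ?_, ?_⟩ hk
  · intro a m
    exact Subtype.ext (Hr.smul a m.1)
  · rintro ⟨w, hw⟩
    obtain ⟨g, rfl⟩ := Hr.surj w
    rw [LinearMap.mem_ker, indMap_nat h ιr ι f.toAddMonoidHom _ (indExt_apply H f)] at hw
    have h0 := H.uniq _ hw
    have h1 : ∀ i, f (g i) = 0 := fun i => DFunLike.congr_fun h0 i
    classical
    refine ⟨Finsupp.onFinset g.support (fun i => ⟨g i, h1 i⟩) ?_, Subtype.ext ?_⟩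
    · intro i hi
      rw [Finsupp.mem_support_iff]
      intro h2
      exact hi (Subtype.ext h2)
    · rw [key]
      congr 1
      ext1 i
      rfl
  · intro g hg
    have h0 := Hr.uniq _ ((key g).symm.trans (congrArg Subtype.val hg))
    ext1 i
    exact Subtype.ext (DFunLike.congr_fun h0 i)

theorem IsInd.modFP_zero {M0 M : Type*} [AddCommGroup M0] [AddCommGroup M]
    [Module S0 M0] [Module S M] {ι : M0 →+ M} (H : IsInd j h ι)
    (hM : ModFP S0 0 M0) : ModFP S 0 M := by
  rw [_root_.modFP_zero] at *
  obtain ⟨r, f, hf⟩ := Module.Finite.exists_fin' S0 M0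
  exact Module.Finite.of_surjective _ (indExt_surj H f hf)

theorem IsInd.modFP_aux (hR : IsInd j h j.toAddMonoidHom) (k : ℕ) :
    ∀ {M0 : Type u} {M : Type v} [AddCommGroup M0] [AddCommGroup M]
      [Module S0 M0] [Module S M] {ι : M0 →+ M}, IsInd j h ι →
      ModFP S0 k M0 → ModFP S k M := by
  induction k with
  | zero => intro M0 M _ _ _ _ ι H; exact H.modFP_zero
  | succ k ih => intro M0 M _ _ _ _ ι H; exact IsInd.modFP_step hR ih H

theorem IsInd.modFP (hR : IsInd j h j.toAddMonoidHom) {k : ℕ}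
    {M0 M : Type*} [AddCommGroup M0] [AddCommGroup M]
    [Module S0 M0] [Module S M] {ι : M0 →+ M} (H : IsInd j h ι)
    (hM : ModFP S0 k M0) : ModFP S k M := by
  cases k with
  | zero => exact H.modFP_zero hM
  | succ k => exact IsInd.modFP_step hR (IsInd.modFP_aux hR k) H hM

end Induction

section Abstract

variable {S0 S T : Type*} [Ring S0] [Ring S] [Ring T] {I : Type*}

/-- The decomposition map of `S` over `S0`. -/
noncomputable def indMapRing (j : S0 →+* S) (h : I → S) : (I →₀ S0) →+ S :=
  indMap h j.toAddMonoidHom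

theorem indMapRing_single (j : S0 →+* S) (h : I → S) (i : I) (x : S0) :
    indMapRing j h (Finsupp.single i x) = h i * j x := indMap_single _ _ _ _

/-- The elements `h i` form a basis of `S` as a right `S0`-module. -/
structure IsIndRing (j : S0 →+* S) (h : I → S) : Prop where
  surj : Function.Surjective (indMapRing j h)
  uniq : ∀ g, indMapRing j h g = 0 → g = 0

/-- The decomposition map of `T` over `M0`. -/
noncomputable def indMapQuot {M0 : Type*} [AddCommGroup M0] (φ : S →+* T) (h : I → S)
    (ι : M0 →+ T) : (I →₀ M0) →+ T :=
  letI : Module S T := Module.compHom T φ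
  indMap h ι

theorem indMapQuot_single {M0 : Type*} [AddCommGroup M0] (φ : S →+* T) (h : I → S)
    (ι : M0 →+ T) (i : I) (x : M0) :
    indMapQuot φ h ι (Finsupp.single i x) = φ (h i) * ι x :=
  letI : Module S T := Module.compHom T φ
  indMap_single h ι i x

/-- The `S`-module `T` is induced from the `S0`-module `M0`. -/
structure IsIndQuot {M0 : Type*} [AddCommGroup M0] [Module S0 M0] (j : S0 →+* S) (φ : S →+* T)
    (h : I → S) (ι : M0 →+ T) : Prop where
  smul : ∀ a m, ι (a • m) = φ (j a) * ι m
  surj : Function.Surjective (indMapQuot φ h ι)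
  uniq : ∀ g, indMapQuot φ h ι g = 0 → g = 0

theorem modFP_iff_of_ind {M : Type*} [AddCommGroup M] [Module S0 M] [Module S M] [Module T M]
    {j : S0 →+* S} {φ : S →+* T} {h : I → S} {ι : M →+ T}
    (hR : IsIndRing j h) (hQ : IsIndQuot j φ h ι)
    (hM : ∀ (a : S) (m : M), a • m = φ a • m) {k : ℕ} (hk : ModFP S0 k M) :
    ModFP S k M ↔ ModFP T k M := by
  letI : Module S T := Module.compHom T φ
  have hsm : ∀ (a : S) (b : T), a • b = φ a * b := fun a b => rfl
  haveI : IsScalarTower S T T := ⟨fun a b c => by simp only [hsm, smul_eq_mul, mul_assoc]⟩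
  haveI : IsScalarTower S T M := ⟨fun a b c => by rw [hsm, mul_smul, hM]⟩
  have h1 : IsInd j h j.toAddMonoidHom := ⟨fun a m => map_mul j a m, hR.surj, hR.uniq⟩
  have h2 : IsInd j h ι := ⟨hQ.smul, hQ.surj, hQ.uniq⟩
  have hT : ModFP S k T := IsInd.modFP h1 h2 hk
  exact ⟨fun h => hT.extend M h, fun h => hT.restrict M h⟩

end Abstract

/-! ### Resolutions -/

section Resolution

theorem modFP_of_res_step {S : Type u} [Ring S] {n : ℕ}
    (ih : ∀ (M : Type w) [AddCommGroup M] [Module S M]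
      (P : ℕ → Type w) [∀ i, AddCommGroup (P i)] [∀ i, Module S (P i)]
      (d : ∀ i, P (i + 1) →ₗ[S] P i) (ε : P 0 →ₗ[S] M)
      (_ : ∀ i ≤ n, Module.Finite S (P i)) (_ : ∀ i ≤ n, Module.Projective S (P i))
      (_ : Function.Surjective ε) (_ : 0 < n → LinearMap.range (d 0) = LinearMap.ker ε)
      (_ : ∀ i, i + 2 ≤ n → LinearMap.range (d (i + 1)) = LinearMap.ker (d i)),
      ModFP S n M)
    (M : Type*) [AddCommGroup M] [Module S M]
    (P : ℕ → Type w) [∀ i, AddCommGroup (P i)] [∀ i, Module S (P i)]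
    (d : ∀ i, P (i + 1) →ₗ[S] P i) (ε : P 0 →ₗ[S] M)
    (hfin : ∀ i ≤ n + 1, Module.Finite S (P i))
    (hproj : ∀ i ≤ n + 1, Module.Projective S (P i))
    (hε : Function.Surjective ε) (h0 : 0 < n + 1 → LinearMap.range (d 0) = LinearMap.ker ε)
    (hd : ∀ i, i + 2 ≤ n + 1 → LinearMap.range (d (i + 1)) = LinearMap.ker (d i)) :
    ModFP S (n + 1) M := by
  have h0' := h0 (Nat.succ_pos n)
  have := hfin 0 (Nat.zero_le _)
  have := hproj 0 (Nat.zero_le _)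
  refine ModFP.quot ε hε ?_ (ModFP.proj (n + 1) (P 0))
  refine ih (LinearMap.ker ε) (fun i => P (i + 1)) (fun i => d (i + 1))
    (LinearMap.codRestrict _ (d 0) (fun x => h0' ▸ LinearMap.mem_range_self (d 0) x))
    (fun i hi => hfin _ (by omega)) (fun i hi => hproj _ (by omega)) ?_ ?_ ?_
  · rintro ⟨x, hx⟩
    rw [← h0'] at hx
    obtain ⟨y, rfl⟩ := hx
    exact ⟨y, rfl⟩
  · intro hn
    rw [LinearMap.ker_codRestrict]
    exact hd 0 (by omega)
  · intro i hi
    exact hd (i + 1) (by omega)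

theorem modFP_of_res_aux {S : Type u} [Ring S] (n : ℕ) :
    ∀ (M : Type w) [AddCommGroup M] [Module S M]
      (P : ℕ → Type w) [∀ i, AddCommGroup (P i)] [∀ i, Module S (P i)]
      (d : ∀ i, P (i + 1) →ₗ[S] P i) (ε : P 0 →ₗ[S] M)
      (_ : ∀ i ≤ n, Module.Finite S (P i)) (_ : ∀ i ≤ n, Module.Projective S (P i))
      (_ : Function.Surjective ε) (_ : 0 < n → LinearMap.range (d 0) = LinearMap.ker ε)
      (_ : ∀ i, i + 2 ≤ n → LinearMap.range (d (i + 1)) = LinearMap.ker (d i)),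
      ModFP S n M := by
  induction n with
  | zero =>
    intro M _ _ P _ _ d ε hfin _ hε _ _
    have := hfin 0 le_rfl
    exact Module.Finite.of_surjective ε hε
  | succ n ih => intro M _ _ P _ _ d ε; exact modFP_of_res_step ih M P d ε

theorem modFP_of_witness {R : Type u} [Ring R] {G : Type v} [Group G] {n : ℕ}
    (h : Group.IsTypeFP R G n) : ModFP (MonoidAlgebra R G) n R := by
  obtain ⟨W⟩ := h
  letI := W.addCommGroup
  letI := W.module
  cases n with
  | zero =>
    have := W.finite 0 le_rfl
    exact Module.Finite.of_surjective W.ε W.surjective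
  | succ n =>
    exact modFP_of_res_step (modFP_of_res_aux n) R W.P W.d W.ε W.finite W.projective
      W.surjective W.exact_zero W.exact

/-- Free resolution data. -/
def HasFreeRes (S : Type u) [Ring S] (n : ℕ) (M : Type v) [AddCommGroup M] [Module S M] : Prop :=
  ∃ (r : ℕ → ℕ) (d : ∀ i, (Fin (r (i + 1)) → S) →ₗ[S] (Fin (r i) → S))
    (ε : (Fin (r 0) → S) →ₗ[S] M), Function.Surjective ε ∧
    (0 < n → LinearMap.range (d 0) = LinearMap.ker ε) ∧
    (∀ i, i + 2 ≤ n → LinearMap.range (d (i + 1)) = LinearMap.ker (d i))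

theorem hasFreeRes_zero {S : Type u} [Ring S] {M : Type v} [AddCommGroup M] [Module S M]
    (h : ModFP S 0 M) : HasFreeRes S 0 M := by
  rw [modFP_zero] at h
  obtain ⟨r, f, hf⟩ := Module.Finite.exists_fin' S M
  exact ⟨fun _ => r, fun _ => 0, f, hf, fun h => absurd h (lt_irrefl _),
    fun i hi => absurd hi (by omega)⟩

theorem hasFreeRes_step {S : Type u} [Ring S] {n : ℕ} {M : Type v} [AddCommGroup M] [Module S M]
    (ih : ∀ {M : Type u} [AddCommGroup M] [Module S M], ModFP S n M → HasFreeRes S n M)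
    (h : ModFP S (n + 1) M) : HasFreeRes S (n + 1) M := by
  rw [modFP_succ] at h
  obtain ⟨s, f, hf, hk⟩ := h
  obtain ⟨r, d, ε, hε, h0, hd⟩ := ih hk
  let r' : ℕ → ℕ := fun i => Nat.casesOn i s r
  let d' : ∀ i, (Fin (r' (i + 1)) → S) →ₗ[S] (Fin (r' i) → S) := fun i =>
    Nat.casesOn (motive := fun i => (Fin (r' (i + 1)) → S) →ₗ[S] (Fin (r' i) → S)) i
      ((LinearMap.ker f).subtype ∘ₗ ε) d
  refine ⟨r', d', f, hf, fun _ => ?_, fun i hi => ?_⟩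
  · change LinearMap.range ((LinearMap.ker f).subtype ∘ₗ ε) = LinearMap.ker f
    rw [LinearMap.range_comp, LinearMap.range_eq_top.2 hε, Submodule.map_top,
      Submodule.range_subtype]
  · cases i with
    | zero =>
      change LinearMap.range (d 0) = LinearMap.ker ((LinearMap.ker f).subtype ∘ₗ ε)
      rw [h0 (by omega), LinearMap.ker_comp_of_ker_eq_bot _ (Submodule.ker_subtype _)]
    | succ i => exact hd i (by omega)

theorem hasFreeRes_aux {S : Type u} [Ring S] (n : ℕ) :
    ∀ {M : Type u} [AddCommGroup M] [Module S M], ModFP S n M → HasFreeRes S n M := by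
  induction n with
  | zero => intro M _ _; exact hasFreeRes_zero
  | succ n ih => intro M _ _; exact hasFreeRes_step ih

theorem isTypeFP_of_modFP {R : Type u} [Ring R] {G : Type v} [Group G] {n : ℕ}
    (h : ModFP (MonoidAlgebra R G) n R) : Group.IsTypeFP R G n := by
  have h' : HasFreeRes (MonoidAlgebra R G) n R := by
    cases n with
    | zero => exact hasFreeRes_zero h
    | succ n => exact hasFreeRes_step (hasFreeRes_aux n) h
  obtain ⟨r, d, ε, hε, h0, hd⟩ := h'
  exact ⟨{ P := fun i => Fin (r i) → MonoidAlgebra R G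
           d := d
           ε := ε
           finite := fun i _ => inferInstance
           projective := fun i _ => inferInstance
           surjective := hε
           exact_zero := h0
           exact := hd }⟩

end Resolution

/-! ### Group extensions -/

section Extension

variable {R : Type*} [Ring R] {K H L : Type*} [Group K] [Group H] [Group L]

theorem augmentation_single {G : Type*} [Group G] (g : G) (r : R) :
    augmentation R G (MonoidAlgebra.single g r) = r := by
  simp [augmentation, MonoidAlgebra.liftNCRingHom]

theorem triv_smul {G : Type*} [Group G] (a : MonoidAlgebra R G) (r : R) :
    a • r = augmentation R G a * r := rfl

theorem augmentation_map (φ : H →* L) (a : MonoidAlgebra R H) :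
    augmentation R L (MonoidAlgebra.mapDomainRingHom R φ a) = augmentation R H a := by
  induction a using MonoidAlgebra.induction_linear with
  | zero => simp
  | add a b ha hb => simp only [map_add, ha, hb]
  | single g r => simp [augmentation_single]

theorem isInd_groupRing (j : K →* H) (hj : Function.Injective j) (φ : H →* L)
    (hK : j.range = φ.ker) (s : L → H) (hs : ∀ l, φ (s l) = l) :
    IsIndRing (MonoidAlgebra.mapDomainRingHom R j)
      (fun l => (MonoidAlgebra.single (s l) 1 : MonoidAlgebra R H)) := by
  have hjφ : ∀ k, φ (j k) = 1 := fun k => by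
    rw [← MonoidHom.mem_ker, ← hK]; exact ⟨k, rfl⟩
  refine ⟨?_, ?_⟩
  · intro m
    change m ∈ AddMonoidHom.range _
    induction m using MonoidAlgebra.induction_linear with
    | zero => exact zero_mem _
    | add a b ha hb => exact add_mem ha hb
    | single g r =>
      have : (s (φ g))⁻¹ * g ∈ j.range := by
        rw [hK, MonoidHom.mem_ker, map_mul, map_inv, hs, inv_mul_cancel]
      obtain ⟨k, hk⟩ := this
      refine ⟨Finsupp.single (φ g) (MonoidAlgebra.single k r), ?_⟩
      rw [indMapRing_single]
      simp [MonoidAlgebra.single_mul_single, hk]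
  · intro g hg
    have key : ∀ (g : L →₀ MonoidAlgebra R K) (l : L) (k : K),
        (indMapRing (MonoidAlgebra.mapDomainRingHom R j)
          (fun l => (MonoidAlgebra.single (s l) 1 : MonoidAlgebra R H)) g).coeff (s l * j k)
        = (g l).coeff k := by
      intro g l k
      induction g using Finsupp.induction_linear with
      | zero => simp
      | add a b ha hb =>
        simp only [map_add, MonoidAlgebra.coeff_add, Finsupp.add_apply, ha, hb]
      | single l' x =>
        rw [indMapRing_single]
        induction x using MonoidAlgebra.induction_linear with
        | zero => simp
        | add a b ha hb =>
          simp only [map_add, mul_add, MonoidAlgebra.coeff_add, Finsupp.add_apply,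
            Finsupp.single_add, ha, hb]
        | single k' r =>
          classical
          have e : s l' * j k' = s l * j k ↔ l' = l ∧ k' = k := by
            constructor
            · intro h
              have h1 : l' = l := by simpa [hs, hjφ] using congrArg φ h
              subst h1
              exact ⟨rfl, hj (mul_left_cancel h)⟩
            · rintro ⟨rfl, rfl⟩; rfl
          rw [MonoidAlgebra.mapDomainRingHom_apply, MonoidAlgebra.mapDomain_single,
            MonoidAlgebra.single_mul_single, one_mul, MonoidAlgebra.coeff_single,
            Finsupp.single_apply]
          by_cases h1 : l' = l
          · subst h1
            simp [Finsupp.single_apply, hj.eq_iff]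
          · simp [e, h1]
    ext l k
    rw [← key g l k, hg]; simp

theorem isInd_quotient (j : K →* H) (φ : H →* L)
    (hK : j.range = φ.ker) (s : L → H) (hs : ∀ l, φ (s l) = l) :
    IsIndQuot (M0 := R) (MonoidAlgebra.mapDomainRingHom R j)
      (MonoidAlgebra.mapDomainRingHom R φ)
      (fun l => (MonoidAlgebra.single (s l) 1 : MonoidAlgebra R H))
      (MonoidAlgebra.singleAddHom (1 : L)) := by
  have hjφ : ∀ k, φ (j k) = 1 := fun k => by
    rw [← MonoidHom.mem_ker, ← hK]; exact ⟨k, rfl⟩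
  have key : ∀ g : L →₀ R, indMapQuot (MonoidAlgebra.mapDomainRingHom R φ)
      (fun l => (MonoidAlgebra.single (s l) 1 : MonoidAlgebra R H))
      (MonoidAlgebra.singleAddHom (1 : L)) g = MonoidAlgebra.ofCoeff g := by
    intro g
    induction g using Finsupp.induction_linear with
    | zero => simp
    | add a b ha hb => rw [map_add, ha, hb]; rfl
    | single l x =>
      rw [indMapQuot_single]
      simp [MonoidAlgebra.single_mul_single, hs]
  refine ⟨?_, ?_, ?_⟩
  · intro a m
    rw [triv_smul]
    induction a using MonoidAlgebra.induction_linear with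
    | zero => simp
    | add a b ha hb => simp only [map_add, add_mul, ha, hb]
    | single g r => simp [augmentation_single, hjφ, MonoidAlgebra.single_mul_single]
  · intro m
    exact ⟨m.coeff, key _⟩
  · intro g hg
    rw [key] at hg
    exact MonoidAlgebra.ofCoeff_eq_zero.1 hg

theorem isTypeFP_group_ext (j : K →* H) (hj : Function.Injective j) (φ : H →* L)
    (hφ : Function.Surjective φ) (hK : j.range = φ.ker) {k : ℕ}
    (hKfp : Group.IsTypeFP R K k) :
    Group.IsTypeFP R H k ↔ Group.IsTypeFP R L k := by
  choose s hs using hφ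
  have := modFP_iff_of_ind (isInd_groupRing j hj φ hK s hs) (isInd_quotient j φ hK s hs)
      (fun a m => by rw [triv_smul, triv_smul, augmentation_map]) (modFP_of_witness hKfp)
  exact ⟨fun h => isTypeFP_of_modFP (this.1 (modFP_of_witness h)),
    fun h => isTypeFP_of_modFP (this.2 (modFP_of_witness h))⟩

theorem isTypeFP_mono {k l : ℕ} (hkl : k ≤ l) (h : Group.IsTypeFP R H l) :
    Group.IsTypeFP R H k :=
  isTypeFP_of_modFP ((modFP_of_witness h).mono hkl)

end Extension

/-- Homological extension inheritance, part (i): let `R` be a nontrivial ring,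
`n < m`, and let `p : G → Q` be a surjective group homomorphism with kernel `N`.
If every subgroup of `Q` of type `FP_n(R)` is of type `FP_m(R)` and every subgroup of
`N` is of type `FP_m(R)`, then every subgroup of `G` of type `FP_n(R)` is of type
`FP_m(R)`. -/
theorem fp_coherent_of_group_extension {R : Type*} [Ring R] [Nontrivial R]
    {G Q : Type*} [Group G] [Group Q] (n m : ℕ) (hnm : n < m)
    (p : G →* Q) (hp : Function.Surjective p) (N : Subgroup G) (hN : N = p.ker)
    (hQ : ∀ K : Subgroup Q, Group.IsTypeFP R K n → Group.IsTypeFP R K m)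
    (hNfp : ∀ K : Subgroup ↥N, Group.IsTypeFP R K m) :
    ∀ H : Subgroup G, Group.IsTypeFP R H n → Group.IsTypeFP R H m := by
  intro H hH
  subst hN
  let K : Subgroup p.ker := H.subgroupOf p.ker
  let j : K →* H :=
    { toFun := fun x => ⟨x.1.1, x.2⟩
      map_one' := rfl
      map_mul' := fun _ _ => rfl }
  have hj : Function.Injective j := fun x y hxy =>
    Subtype.ext (Subtype.ext (congrArg (fun z : H => (z : G)) hxy))
  let φ : H →* H.map p := p.subgroupMap H
  have hφ : Function.Surjective φ := p.subgroupMap_surjective H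
  have hK : j.range = φ.ker := by
    ext x
    rw [MonoidHom.mem_ker]
    constructor
    · rintro ⟨y, rfl⟩
      exact Subtype.ext y.1.2
    · intro hx
      exact ⟨⟨⟨x.1, congrArg Subtype.val hx⟩, x.2⟩, rfl⟩
  have hKm := hNfp K
  rw [isTypeFP_group_ext j hj φ hφ hK hKm]
  apply hQ
  rwa [← isTypeFP_group_ext j hj φ hφ hK (isTypeFP_mono hnm.le hKm)]
end
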